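/- Let P = P_{n,r} be the poset of r-colored injective words with the natural 𝔖_n-action, let S = {s_1 < ⋯ < s_k} ⊆ {1,…,n−1} and let λ be a partition of n. Then the multiplicity b_{r,λ}(S ∪ {n}) of ρ^λ in β_P(S ∪ {n}) is equal to the number of pairs (w,Q) where w ∈ 𝔖_n has descent set S, Q is an r-colored standard Young tableau of shape λ, and τ(w,Q) is even. -/

import Mathlib

open scoped Classical

noncomputable section

/-! ### Permutation combinatorics -/

/-- The value `w(i)` (1-based, in `{1,…,n}`) of a permutation `w` of `{1,…,n}`,
realized as `Equiv.Perm (Fin n)`. -/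
def permApp {n : ℕ} (w : Equiv.Perm (Fin n)) (i : ℕ) : ℕ :=
  if h : i - 1 < n then (w ⟨i - 1, h⟩ : ℕ) + 1 else 0

/-- The descent set of a permutation, a subset of `{1,…,n-1}`. -/
def descentSet {n : ℕ} (w : Equiv.Perm (Fin n)) : Finset ℕ :=
  (Finset.Icc 1 (n - 1)).filter fun i => permApp w (i + 1) < permApp w i

/-- `numDescentSet m T` is the number of permutations in `𝔖_m` with descent set `T`. -/
def numDescentSet (m : ℕ) (T : Finset ℕ) : ℕ :=
  Nat.card {w : Equiv.Perm (Fin m) // descentSet w = T}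

/-- The Coxeter length (number of inversions) of a permutation. -/
def invCount {n : ℕ} (w : Equiv.Perm (Fin n)) : ℕ :=
  (Finset.univ.filter fun p : Fin n × Fin n => p.1 < p.2 ∧ w p.2 < w p.1).card

/-- For `S = {s_1 < s_2 < ⋯ < s_k} ⊆ {1,…,n-1}`, `sElt n S j = s_j`, with the
conventions `s_0 = 0` and `s_j = n` for `j > k`. -/
def sElt (n : ℕ) (S : Finset ℕ) (j : ℕ) : ℕ :=
  if j = 0 then 0 else if j ≤ S.card then (S.sort (· ≤ ·)).getD (j - 1) 0 else n

lemma sElt_of_gt (n : ℕ) (S : Finset ℕ) (j : ℕ) (h : S.card < j) : sElt n S j = n := by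
  unfold sElt
  rw [if_neg (by omega), if_neg (by omega)]

/-! ### Standard Young tableaux -/

/-- A standard Young tableau of shape `μ`: a filling of the cells of `μ` by the numbers
`1,…,μ.card`, each used once, strictly increasing along rows and columns
(the entry of a non-cell is `0`). -/
structure SYT (μ : YoungDiagram) where
  entry : ℕ → ℕ → ℕ
  entry_eq_zero : ∀ i j, (i, j) ∉ μ → entry i j = 0
  row_strict : ∀ i j1 j2, j1 < j2 → (i, j2) ∈ μ → entry i j1 < entry i j2
  col_strict : ∀ i1 i2 j, i1 < i2 → (i2, j) ∈ μ → entry i1 j < entry i2 j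
  bijOn : Set.BijOn (fun p : ℕ × ℕ => entry p.1 p.2) ↑μ.cells ↑(Finset.Icc 1 μ.card)

/-- The descent set of a standard Young tableau: those `k` such that `k+1` lies in a
strictly lower row than `k`. -/
def SYT.des {μ : YoungDiagram} (Q : SYT μ) : Finset ℕ :=
  (Finset.Icc 1 (μ.card - 1)).filter fun k =>
    ∃ p1 ∈ μ.cells, ∃ p2 ∈ μ.cells,
      Q.entry p1.1 p1.2 = k ∧ Q.entry p2.1 p2.2 = k + 1 ∧ p1.1 < p2.1

/-- `fSYTRow μ t` is the number of standard Young tableaux of shape `μ` whose first row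
contains the numbers `1,…,t`. -/
def fSYTRow (μ : YoungDiagram) (t : ℕ) : ℕ :=
  Nat.card {Q : SYT μ // ∀ k, 1 ≤ k → k ≤ t → ∃ j, (0, j) ∈ μ ∧ Q.entry 0 j = k}

/-! ### Irreducible characters of the symmetric group, via Jacobi–Trudi -/

/-- The number of functions `f : Fin n → Fin k` which are invariant under `g` and whose
fiber over `i` has `c i` elements.  For `c` a composition of `n`, the function
`g ↦ fixedYoungFns n k c g` is the character of the permutation representation of `𝔖_n`
on ordered set partitions of `{1,…,n}` of type `c`, i.e. of the representation induced
from the trivial representation of the corresponding Young subgroup. -/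
def fixedYoungFns (n k : ℕ) (c : Fin k → ℤ) (g : Equiv.Perm (Fin n)) : ℕ :=
  Nat.card {f : Fin n → Fin k //
    (∀ x, f (g x) = f x) ∧ ∀ i, ((Nat.card {x : Fin n // f x = i} : ℕ) : ℤ) = c i}

/-- The irreducible character `χ^μ` of `𝔖_n` associated to a partition `μ` of `n`
(encoded as a Young diagram with `n` cells), defined through the Jacobi–Trudi
determinantal formula `χ^μ = det (h_{μ_i - i + j})`. -/
def chi (n : ℕ) (μ : YoungDiagram) (g : Equiv.Perm (Fin n)) : ℤ :=
  ∑ σ : Equiv.Perm (Fin μ.rowLens.length),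
    ((Equiv.Perm.sign σ : ℤˣ) : ℤ) *
      (fixedYoungFns n μ.rowLens.length
        (fun i => ((μ.rowLen (i : ℕ) : ℕ) : ℤ) - ((i : ℕ) : ℤ) + ((σ i : ℕ) : ℤ)) g : ℤ)

/-! ### Posets, rank selection, maximal chains and characters -/

/-- The maximal chains of the subposet induced on a subset `A` of a poset. -/
def maxChainsIn {P : Type*} [Preorder P] (A : Set P) : Set (Set P) :=
  {C | C ⊆ A ∧ IsChain (· ≤ ·) C ∧
    ∀ D : Set P, D ⊆ A → IsChain (· ≤ ·) D → C ⊆ D → C = D}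

/-- The rank-selected subposet `P_S = {x ∈ P : rk x ∈ S} ∪ {⊥, ⊤}`. -/
def rankSel {P : Type*} [Preorder P] [OrderBot P] [OrderTop P] (rk : P → ℕ)
    (S : Finset ℕ) : Set P :=
  {x | rk x ∈ S} ∪ {⊥, ⊤}

/-- `a_P(S)`: the number of maximal chains of the rank-selected subposet `P_S`. -/
def chainCount {P : Type*} [Preorder P] [OrderBot P] [OrderTop P] (rk : P → ℕ)
    (S : Finset ℕ) : ℕ :=
  Set.ncard (maxChainsIn (rankSel rk S))

/-- `b_P(S) = Σ_{T ⊆ S} (-1)^{|S-T|} a_P(T)`. -/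
def bDim {P : Type*} [Preorder P] [OrderBot P] [OrderTop P] (rk : P → ℕ)
    (S : Finset ℕ) : ℤ :=
  ∑ T ∈ S.powerset, (-1 : ℤ) ^ (S.card - T.card) * (chainCount rk T : ℤ)

/-- The character of the permutation representation `α_P(S)` of a group `G` acting (via
`act`) on the maximal chains of the rank-selected subposet `P_S`: its value at `g` is
the number of maximal chains of `P_S` fixed by `g`. -/
def gAlpha {P G : Type*} [Preorder P] [OrderBot P] [OrderTop P] (rk : P → ℕ)
    (act : G → P → P) (S : Finset ℕ) (g : G) : ℤ :=
  (Set.ncard {C : Set P | C ∈ maxChainsIn (rankSel rk S) ∧ act g '' C = C} : ℤ)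

/-- The character of the virtual representation
`β_P(S) = Σ_{T ⊆ S} (-1)^{|S-T|} α_P(T)`. -/
def gBeta {P G : Type*} [Preorder P] [OrderBot P] [OrderTop P] (rk : P → ℕ)
    (act : G → P → P) (S : Finset ℕ) (g : G) : ℤ :=
  ∑ T ∈ S.powerset, (-1 : ℤ) ^ (S.card - T.card) * gAlpha rk act T g

/-! ### The poset of injective words -/

/-- An injective word over the alphabet `{1,…,n}`. -/
def InjWord (n : ℕ) : Type := {l : List (Fin n) // l.Nodup}

instance (n : ℕ) : PartialOrder (InjWord n) where
  le u v := u.1.Sublist v.1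
  le_refl u := List.Sublist.refl _
  le_trans u v w h1 h2 := List.Sublist.trans h1 h2
  le_antisymm u v h1 h2 := Subtype.ext (List.Sublist.antisymm h1 h2)

instance (n : ℕ) : OrderBot (InjWord n) where
  bot := ⟨[], List.nodup_nil⟩
  bot_le u := List.nil_sublist u.1

/-- The rank function of the poset of injective words (with a maximum adjoined):
the rank of a word is its length, and the rank of `⊤` is `n+1`. -/
def rkInj (n : ℕ) (x : WithTop (InjWord n)) : ℕ :=
  WithTop.recTopCoe (n + 1) (fun u => u.1.length) x

/-- The action of `𝔖_n` on injective words, letter by letter. -/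
def permWord {n : ℕ} (w : Equiv.Perm (Fin n)) (u : InjWord n) : InjWord n :=
  ⟨u.1.map w, u.2.map w.injective⟩

/-- The character of `α_{P_n}(S)` for the `𝔖_n`-action on the poset of injective words. -/
def injAlpha (n : ℕ) (S : Finset ℕ) (g : Equiv.Perm (Fin n)) : ℤ :=
  gAlpha (rkInj n) (fun w : Equiv.Perm (Fin n) => WithTop.map (permWord w)) S g

/-- The character of `β_{P_n}(S)` for the `𝔖_n`-action on the poset of injective words. -/
def injBeta (n : ℕ) (S : Finset ℕ) (g : Equiv.Perm (Fin n)) : ℤ :=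
  gBeta (rkInj n) (fun w : Equiv.Perm (Fin n) => WithTop.map (permWord w)) S g

/-! ### The poset of r-colored injective words -/

/-- An `r`-colored injective word over `{1,…,n}`: a word in the alphabet
`{1,…,n} × ℤ_r` whose letters have pairwise distinct first coordinates. -/
def CInjWord (n r : ℕ) : Type := {l : List (Fin n × ZMod r) // (l.map Prod.fst).Nodup}

instance (n r : ℕ) : PartialOrder (CInjWord n r) where
  le u v := u.1.Sublist v.1
  le_refl u := List.Sublist.refl _
  le_trans u v w h1 h2 := List.Sublist.trans h1 h2
  le_antisymm u v h1 h2 := Subtype.ext (List.Sublist.antisymm h1 h2)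

instance (n r : ℕ) : OrderBot (CInjWord n r) where
  bot := ⟨[], by simp⟩
  bot_le u := List.nil_sublist u.1

/-- The rank function of the poset `P_{n,r}` of `r`-colored injective words
(with a maximum adjoined). -/
def rkC (n r : ℕ) (x : WithTop (CInjWord n r)) : ℕ :=
  WithTop.recTopCoe (n + 1) (fun u => u.1.length) x

/-- The action of `𝔖_n` on `r`-colored injective words: act on the first coordinate
of each letter, leaving colors unchanged. -/
def permCWord {n r : ℕ} (w : Equiv.Perm (Fin n)) (u : CInjWord n r) : CInjWord n r :=
  ⟨u.1.map (fun p => (w p.1, p.2)), by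
    have h := u.2.map w.injective
    rw [List.map_map] at h ⊢
    exact h⟩

/-- The character of `α_{P_{n,r}}(S)`. -/
def cAlpha (n r : ℕ) (S : Finset ℕ) (g : Equiv.Perm (Fin n)) : ℤ :=
  gAlpha (rkC n r) (fun w : Equiv.Perm (Fin n) => WithTop.map (permCWord w)) S g

/-- The character of `β_{P_{n,r}}(S)`. -/
def cBeta (n r : ℕ) (S : Finset ℕ) (g : Equiv.Perm (Fin n)) : ℤ :=
  gBeta (rkC n r) (fun w : Equiv.Perm (Fin n) => WithTop.map (permCWord w)) S g

/-- `b_{P_{n,r}}(S)`, the dimension of `β_{P_{n,r}}(S)`. -/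
def cChainDim (n r : ℕ) (S : Finset ℕ) : ℤ := bDim (rkC n r) S

/-! ### The statistics τ -/

/-- `τ(w,Q)` for a permutation `w` with descent set `S = {s_1 < ⋯ < s_k}` and a standard
Young tableau `Q`: the largest `i ∈ {0,…,k+1}` such that (a) `w(x) = w_S(x)` for
`x > s_{k+1-i}` and (b) no descent of `Q` is smaller than `n - s_{k+1-i}`. -/
def tau (n : ℕ) (S : Finset ℕ) (wS w : Equiv.Perm (Fin n)) {μ : YoungDiagram}
    (Q : SYT μ) : ℕ :=
  ((Finset.range (S.card + 2)).filter
    (fun i => (∀ x, sElt n S (S.card + 1 - i) < x → x ≤ n → permApp w x = permApp wS x) ∧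
      (∀ d ∈ Q.des, n - sElt n S (S.card + 1 - i) ≤ d))).max'
    ⟨0, by
      have hs := sElt_of_gt n S (S.card + 1 - 0) (by omega)
      refine Finset.mem_filter.2 ⟨Finset.mem_range.2 (by omega), ?_, ?_⟩
      · intro x hx hx'
        rw [hs] at hx
        exact absurd hx (not_lt.2 hx')
      · intro d _
        rw [hs]
        omega⟩

/-- The condition that all the numbers `1,…,t` appear in the first row of the `r`-colored
standard Young tableau `(Q, c)` and are colored with the zero color (the color of the
entry `k` being `c (k-1)`). -/
def zeroFirstRow {μ : YoungDiagram} {r : ℕ} (Q : SYT μ) (c : Fin μ.card → ZMod r)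
    (t : ℕ) : Prop :=
  ∀ k : Fin μ.card, (k : ℕ) < t →
    ((∃ j, (0, j) ∈ μ ∧ Q.entry 0 j = (k : ℕ) + 1) ∧ c k = 0)

/-- `τ(w,Q)` for an `r`-colored standard Young tableau `(Q,c)`. -/
def ctau (n : ℕ) {r : ℕ} (S : Finset ℕ) (wS w : Equiv.Perm (Fin n)) {μ : YoungDiagram}
    (Q : SYT μ) (c : Fin μ.card → ZMod r) : ℕ :=
  ((Finset.range (S.card + 2)).filter
    (fun i => (∀ x, sElt n S (S.card + 1 - i) < x → x ≤ n → permApp w x = permApp wS x) ∧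
      zeroFirstRow Q c (n - sElt n S (S.card + 1 - i)))).max'
    ⟨0, by
      have hs := sElt_of_gt n S (S.card + 1 - 0) (by omega)
      refine Finset.mem_filter.2 ⟨Finset.mem_range.2 (by omega), ?_, ?_⟩
      · intro x hx hx'
        rw [hs] at hx
        exact absurd hx (not_lt.2 hx')
      · rw [hs]
        intro k hk
        exact absurd hk (by omega)⟩

/-- The largest `i ∈ {0,…,n}` such that all the numbers `1,…,i` appear in the first row
of the `r`-colored standard Young tableau `(Q,c)` and are colored with the zero color. -/
def mQ (n : ℕ) {r : ℕ} {μ : YoungDiagram} (Q : SYT μ) (c : Fin μ.card → ZMod r) : ℕ :=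
  ((Finset.range (n + 1)).filter (fun i => zeroFirstRow Q c i)).max'
    ⟨0, Finset.mem_filter.2 ⟨Finset.mem_range.2 (by omega),
      fun k hk => absurd hk (by omega)⟩⟩

/-- The condition, for an `r`-colored permutation `(π, c)` (the color of the entry
`π(x)` in one-line notation being `c (x-1)`), that the entries `π(1),…,π(t)` are in
increasing order and all colored with the zero color. -/
def zeroIncreasing {n r : ℕ} (π : Equiv.Perm (Fin n)) (c : Fin n → ZMod r) (t : ℕ) : Prop :=
  (∀ x y, 1 ≤ x → x < y → y ≤ t → permApp π x < permApp π y) ∧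
  ∀ k : Fin n, (k : ℕ) < t → c k = 0

/-- `τ(w,u)` for an `r`-colored permutation `u = (π, c)`. -/
def tauU (n : ℕ) {r : ℕ} (S : Finset ℕ) (wS w : Equiv.Perm (Fin n))
    (π : Equiv.Perm (Fin n)) (c : Fin n → ZMod r) : ℕ :=
  ((Finset.range (S.card + 2)).filter
    (fun i => (∀ x, sElt n S (S.card + 1 - i) < x → x ≤ n → permApp w x = permApp wS x) ∧
      zeroIncreasing π c (n - sElt n S (S.card + 1 - i)))).max'
    ⟨0, by
      have hs := sElt_of_gt n S (S.card + 1 - 0) (by omega)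
      refine Finset.mem_filter.2 ⟨Finset.mem_range.2 (by omega), ?_, ?_, ?_⟩
      · intro x hx hx'
        rw [hs] at hx
        exact absurd hx (not_lt.2 hx')
      · intro x y hx hxy hy
        rw [hs] at hy
        exact absurd hy (by omega)
      · rw [hs]
        intro k hk
        exact absurd hk (by omega)⟩

/-- The largest `i ∈ {0,…,n}` such that the entries `π(1),…,π(i)` of the `r`-colored
permutation `(π,c)` are in increasing order and all colored with the zero color. -/
def mU (n : ℕ) {r : ℕ} (π : Equiv.Perm (Fin n)) (c : Fin n → ZMod r) : ℕ :=
  ((Finset.range (n + 1)).filter (fun i => zeroIncreasing π c i)).max'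
    ⟨0, Finset.mem_filter.2 ⟨Finset.mem_range.2 (by omega),
      fun x y hx hxy hy => absurd hy (by omega),
      fun k hk => absurd hk (by omega)⟩⟩

/-- `a_m(T)`: the number of chains in the Boolean lattice `B_m` whose elements have
set of ranks (cardinalities) equal to `T`. -/
def boolChains (m : ℕ) (T : Finset ℕ) : ℕ :=
  Nat.card {c : Finset (Finset (Fin m)) //
    IsChain (· ⊆ ·) (↑c : Set (Finset (Fin m))) ∧ c.image Finset.card = T}

end


/-! ### Signed counts -/

noncomputable def Nw (k t : ℕ) (c : Fin k → ℤ) : ℤ :=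
  ∑ y : Fin t → Fin k,
    if ∀ i, ((Finset.univ.filter fun a => y a = i).card : ℤ) ≤ c i then 1 else 0

noncomputable def Fs (k t : ℕ) (a : Fin k → ℤ) : ℤ :=
  ∑ σ : Equiv.Perm (Fin k), ((Equiv.Perm.sign σ : ℤˣ) : ℤ) *
    Nw k t (fun i => a i + ((σ i : ℕ) : ℤ))

lemma Nw_zero (k : ℕ) (c : Fin k → ℤ) : Nw k 0 c = if ∀ i, 0 ≤ c i then 1 else 0 := by
  simp [Nw]

lemma Nw_succ (k t : ℕ) (c : Fin k → ℤ) :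
    Nw k (t + 1) c = ∑ i, Nw k t (fun j => c j - if j = i then 1 else 0) := by
  unfold Nw
  rw [← Equiv.sum_comp (Fin.consEquiv (fun _ : Fin (t+1) => Fin k)), Fintype.sum_prod_type]
  refine Finset.sum_congr rfl fun i _ => Finset.sum_congr rfl fun y _ => ?_
  congr 1
  refine propext (forall_congr' fun j => ?_)
  have : (Finset.univ.filter fun a : Fin (t+1) =>
      (Fin.consEquiv (fun _ : Fin (t+1) => Fin k)) (i, y) a = j).card =
      (if j = i then 1 else 0) + (Finset.univ.filter fun a => y a = j).card := by
    rw [Fin.card_filter_univ_succ]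
    simp only [Fin.consEquiv_apply, Fin.cons_zero, Fin.cons_succ]
    by_cases h : i = j
    · subst h; simp [add_comm]
    · have h' : ¬ j = i := fun e => h e.symm
      simp [h, h']
  rw [this]
  push_cast
  constructor <;> intro h <;> split_ifs at * <;> linarith

lemma Nw_perm (k t : ℕ) (c : Fin k → ℤ) (π : Equiv.Perm (Fin k)) :
    Nw k t (fun i => c (π i)) = Nw k t c := by
  unfold Nw
  conv_rhs => rw [← Equiv.sum_comp ((Equiv.refl (Fin t)).arrowCongr π)]
  refine Finset.sum_congr rfl fun y _ => ?_
  congr 1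
  refine propext ?_
  conv_rhs => rw [← (Equiv.forall_congr_right π)]
  refine forall_congr' fun j => ?_
  simp

lemma Nw_neg (k t : ℕ) (c : Fin k → ℤ) (i : Fin k) (h : c i < 0) : Nw k t c = 0 := by
  unfold Nw
  refine Finset.sum_eq_zero fun y _ => if_neg fun h' => ?_
  have := h' i
  omega

lemma Fs_succ (k t : ℕ) (a : Fin k → ℤ) :
    Fs k (t + 1) a = ∑ i, Fs k t (fun j => a j - if j = i then 1 else 0) := by
  unfold Fs
  rw [Finset.sum_comm]
  refine Finset.sum_congr rfl fun σ _ => ?_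
  rw [Nw_succ, Finset.mul_sum]
  refine Finset.sum_congr rfl fun i _ => ?_
  congr 2
  funext j
  ring

lemma Fs_eq (k t : ℕ) (a : Fin k → ℤ) (i j : Fin k) (hij : i ≠ j) (h : a i = a j) :
    Fs k t a = 0 := by
  have key : Fs k t a = - Fs k t a := by
    conv_lhs => unfold Fs
    rw [← Equiv.sum_comp (Equiv.mulRight (Equiv.swap i j))]
    unfold Fs
    rw [← Finset.sum_neg_distrib]
    refine Finset.sum_congr rfl fun σ _ => ?_
    have : Nw k t (fun l => a l + (((Equiv.mulRight (Equiv.swap i j)) σ l : ℕ) : ℤ)) =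
        Nw k t (fun l => a l + ((σ l : ℕ) : ℤ)) := by
      rw [← Nw_perm k t (fun l => a l + ((σ l : ℕ) : ℤ)) (Equiv.swap i j)]
      congr 1
      funext l
      have : a (Equiv.swap i j l) = a l := by
        rcases eq_or_ne l i with rfl | h1
        · simp [h]
        · rcases eq_or_ne l j with rfl | h2
          · simp [h]
          · rw [Equiv.swap_apply_of_ne_of_ne h1 h2]
      simp [this]
    rw [this]
    simp [Equiv.Perm.sign_swap hij]
  linarith

lemma Fs_neg (k t : ℕ) (a : Fin k → ℤ) (i : Fin k) (h : a i ≤ - (k : ℤ)) :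
    Fs k t a = 0 := by
  unfold Fs
  refine Finset.sum_eq_zero fun σ _ => ?_
  rw [Nw_neg k t _ i, mul_zero]
  have := (σ i).2
  omega

/-- base case, at least two rows -/
lemma Fs_zero_two (k : ℕ) (a : Fin k → ℤ) (i j : Fin k) (hij : i ≠ j) (hi : 0 ≤ a i)
    (hj : 0 ≤ a j) : Fs k 0 a = 0 := by
  have key : Fs k 0 a = - Fs k 0 a := by
    conv_lhs => unfold Fs
    rw [← Equiv.sum_comp (Equiv.mulRight (Equiv.swap i j))]
    unfold Fs
    rw [← Finset.sum_neg_distrib]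
    refine Finset.sum_congr rfl fun σ _ => ?_
    have : Nw k 0 (fun l => a l + (((Equiv.mulRight (Equiv.swap i j)) σ l : ℕ) : ℤ)) =
        Nw k 0 (fun l => a l + ((σ l : ℕ) : ℤ)) := by
      rw [Nw_zero, Nw_zero]
      congr 1
      refine propext (forall_congr' fun l => ?_)
      rcases eq_or_ne l i with rfl | h1
      · simp; constructor <;> intro <;> positivity
      · rcases eq_or_ne l j with rfl | h2
        · simp; constructor <;> intro <;> positivity
        · simp [Equiv.swap_apply_of_ne_of_ne h1 h2]
    rw [this]
    simp [Equiv.Perm.sign_swap hij]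
  linarith

lemma perm_eq_one_of_le {k : ℕ} (σ : Equiv.Perm (Fin k)) (h : ∀ i, i ≤ σ i) : σ = 1 := by
  ext i
  have hs : ∑ i : Fin k, ((σ i : ℕ)) = ∑ i : Fin k, (i : ℕ) :=
    Equiv.sum_comp σ (fun i => (i : ℕ))
  have := (Finset.sum_eq_sum_iff_of_le (s := Finset.univ) (f := fun i : Fin k => (i : ℕ))
    (g := fun i => (σ i : ℕ)) (fun i _ => h i)).1 hs.symm i (Finset.mem_univ _)
  simpa using this.symm

lemma Fs_zero_one (k : ℕ) (a : Fin k → ℤ) (h0 : ∀ i : Fin k, (i : ℕ) = 0 → 0 ≤ a i)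
    (h : ∀ i : Fin k, (i : ℕ) ≠ 0 → a i = - ((i : ℕ) : ℤ)) : Fs k 0 a = 1 := by
  unfold Fs
  rw [Finset.sum_eq_single 1]
  · rw [Nw_zero, if_pos]
    · simp
    · intro i
      by_cases hi : (i : ℕ) = 0
      · have := h0 i hi
        positivity
      · simp [h i hi]
  · intro σ _ hσ
    rw [Nw_zero, if_neg, mul_zero]
    intro h'
    refine hσ (perm_eq_one_of_le σ fun i => ?_)
    by_cases hi : (i : ℕ) = 0
    · exact Fin.le_def.2 (by omega)
    · have := h' i
      rw [h i hi] at this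
      exact Fin.le_def.2 (by omega)
  · simp


/-! ### Removing a corner of a Young diagram -/

lemma yd_mem (μ : YoungDiagram) (i j : ℕ) : (i, j) ∈ μ ↔ j < μ.rowLen i :=
  YoungDiagram.mem_iff_lt_rowLen

noncomputable def remC (μ : YoungDiagram) (i : ℕ) (h : μ.rowLen (i + 1) < μ.rowLen i) :
    YoungDiagram where
  cells := μ.cells.erase (i, μ.rowLen i - 1)
  isLowerSet := by
    rintro ⟨a, b⟩ ⟨c, d⟩ hle hmem
    simp only [Finset.coe_erase, Set.mem_sdiff, Finset.mem_coe, YoungDiagram.mem_cells,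
      Set.mem_singleton_iff, Prod.mk.injEq, not_and, yd_mem] at hmem ⊢
    obtain ⟨hca, hdb⟩ := Prod.mk_le_mk.1 hle
    have hab : (a, b) ∈ μ := (yd_mem _ _ _).2 hmem.1
    refine ⟨(yd_mem _ _ _).1 (μ.up_left_mem hca hdb hab), ?_⟩
    rintro rfl rfl
    rcases Nat.eq_or_lt_of_le hca with rfl | hlt
    · have := hmem.2 rfl
      omega
    · have := (yd_mem _ _ _).1 (μ.up_left_mem (show c + 1 ≤ a from hlt) hdb hab)
      omega

lemma mem_remC (μ : YoungDiagram) (i : ℕ) (h : μ.rowLen (i + 1) < μ.rowLen i) (a b : ℕ) :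
    (a, b) ∈ remC μ i h ↔ (a, b) ∈ μ ∧ (a, b) ≠ (i, μ.rowLen i - 1) := by
  rw [← YoungDiagram.mem_cells]
  simp only [remC, Finset.mem_erase, YoungDiagram.mem_cells]
  tauto

lemma remC_card (μ : YoungDiagram) (i : ℕ) (h : μ.rowLen (i + 1) < μ.rowLen i) :
    (remC μ i h).card + 1 = μ.card := by
  have : (i, μ.rowLen i - 1) ∈ μ.cells := by
    rw [YoungDiagram.mem_cells, yd_mem]; omega
  exact Finset.card_erase_add_one this

lemma remC_rowLen (μ : YoungDiagram) (i : ℕ) (h : μ.rowLen (i + 1) < μ.rowLen i) (a : ℕ) :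
    (remC μ i h).rowLen a = if a = i then μ.rowLen i - 1 else μ.rowLen a := by
  have key : ∀ b, b < (remC μ i h).rowLen a ↔ b < if a = i then μ.rowLen i - 1 else μ.rowLen a := by
    intro b
    rw [← yd_mem, mem_remC, yd_mem]
    by_cases ha : a = i
    · subst ha; simp; omega
    · simp [ha]
  apply le_antisymm
  · by_contra! hlt; exact absurd ((key _).1 hlt) (lt_irrefl _)
  · by_contra! hlt; exact absurd ((key _).2 hlt) (lt_irrefl _)

/-- the condition that `1,…,m` lie in the first row -/
def frow {μ : YoungDiagram} (Q : SYT μ) (m : ℕ) : Prop :=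
  ∀ k, 1 ≤ k → k ≤ m → ∃ j, (0, j) ∈ μ ∧ Q.entry 0 j = k

lemma SYT.ext' {μ : YoungDiagram} {Q R : SYT μ} (h : ∀ i j, Q.entry i j = R.entry i j) :
    Q = R := by
  cases Q; cases R
  congr
  funext i j
  exact h i j

lemma SYT.le_card {μ : YoungDiagram} (Q : SYT μ) (i j : ℕ) : Q.entry i j ≤ μ.card := by
  by_cases h : (i, j) ∈ μ
  · have := Q.bijOn.mapsTo (show (i, j) ∈ (μ.cells : Set (ℕ × ℕ)) from by simpa using h)
    simp at this
    exact this.2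
  · rw [Q.entry_eq_zero i j h]; omega

lemma SYT.pos {μ : YoungDiagram} (Q : SYT μ) (i j : ℕ) (h : (i, j) ∈ μ) : 1 ≤ Q.entry i j := by
  have := Q.bijOn.mapsTo (show (i, j) ∈ (μ.cells : Set (ℕ × ℕ)) from by simpa using h)
  simp at this
  omega

lemma SYT.inj {μ : YoungDiagram} (Q : SYT μ) {a b c d : ℕ} (h : (a, b) ∈ μ) (h' : (c, d) ∈ μ)
    (he : Q.entry a b = Q.entry c d) : (a, b) = (c, d) :=
  Q.bijOn.injOn (show (a, b) ∈ (μ.cells : Set (ℕ × ℕ)) from by simpa using h)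
    (show (c, d) ∈ (μ.cells : Set (ℕ × ℕ)) from by simpa using h') he

lemma SYT.surj {μ : YoungDiagram} (Q : SYT μ) {k : ℕ} (h1 : 1 ≤ k) (h2 : k ≤ μ.card) :
    ∃ a b, (a, b) ∈ μ ∧ Q.entry a b = k := by
  obtain ⟨⟨a, b⟩, hp, he⟩ := Q.bijOn.surjOn (show k ∈ ((Finset.Icc 1 μ.card : Finset ℕ) : Set ℕ)
    from by simp; omega)
  exact ⟨a, b, by simpa using hp, he⟩

instance SYT.finite (μ : YoungDiagram) : Finite (SYT μ) := by
  refine Finite.of_injective (β := μ.cells → Fin (μ.card + 1))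
    (fun Q p => ⟨Q.entry p.1.1 p.1.2, by have := Q.le_card p.1.1 p.1.2; omega⟩) ?_
  intro Q R h
  refine SYT.ext' fun i j => ?_
  by_cases hm : (i, j) ∈ μ
  · have := congrFun h ⟨(i, j), by simpa using hm⟩
    simpa using this
  · rw [Q.entry_eq_zero i j hm, R.entry_eq_zero i j hm]

/-- the row of the maximal entry -/
lemma SYT.max_corner {μ : YoungDiagram} (Q : SYT μ) {i j : ℕ} (h : (i, j) ∈ μ)
    (he : Q.entry i j = μ.card) : j = μ.rowLen i - 1 ∧ μ.rowLen (i + 1) < μ.rowLen i := by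
  have h0 := (yd_mem _ _ _).1 h
  have h1 : ¬ (i, j + 1) ∈ μ := fun hm => by
    have := Q.row_strict i j (j+1) (by omega) hm
    have := Q.le_card i (j+1)
    omega
  have h2 : ¬ (i + 1, j) ∈ μ := fun hm => by
    have := Q.col_strict i (i+1) j (by omega) hm
    have := Q.le_card (i+1) j
    omega
  rw [yd_mem] at h1 h2
  omega

noncomputable def SYT.rem {μ : YoungDiagram} (i : ℕ) (h : μ.rowLen (i + 1) < μ.rowLen i) (Q : SYT μ)
    (hQ : Q.entry i (μ.rowLen i - 1) = μ.card) : SYT (remC μ i h) where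
  entry a b := if (a, b) = (i, μ.rowLen i - 1) then 0 else Q.entry a b
  entry_eq_zero a b hab := by
    rw [mem_remC] at hab
    split_ifs with h1
    · rfl
    · exact Q.entry_eq_zero a b (by tauto)
  row_strict a b1 b2 hb hm := by
    rw [mem_remC] at hm
    rw [if_neg hm.2, if_neg]
    · exact Q.row_strict a b1 b2 hb hm.1
    · intro he
      simp only [Prod.mk.injEq] at he
      obtain ⟨rfl, rfl⟩ := he
      have := (yd_mem _ _ _).1 hm.1
      omega
  col_strict a1 a2 b hb hm := by
    rw [mem_remC] at hm
    rw [if_neg hm.2, if_neg]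
    · exact Q.col_strict a1 a2 b hb hm.1
    · intro he
      simp only [Prod.mk.injEq] at he
      obtain ⟨rfl, rfl⟩ := he
      have := (yd_mem _ _ _).1 (μ.up_left_mem (show a1 + 1 ≤ a2 from hb) le_rfl hm.1)
      omega
  bijOn := by
    have hc := remC_card μ i h
    have hmem : (i, μ.rowLen i - 1) ∈ μ := by rw [yd_mem]; omega
    refine ⟨?_, ?_, ?_⟩
    · rintro ⟨a, b⟩ hab
      simp only [Finset.mem_coe, YoungDiagram.mem_cells, mem_remC] at hab
      have h1 := Q.pos a b hab.1
      have h2 := Q.le_card a b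
      have h3 : Q.entry a b ≠ μ.card := fun e => hab.2 (Q.inj hab.1 hmem (e.trans hQ.symm))
      simp only [if_neg hab.2, Finset.coe_Icc, Set.mem_Icc]
      omega
    · rintro ⟨a, b⟩ hab ⟨c, d⟩ hcd he
      simp only [Finset.mem_coe, YoungDiagram.mem_cells, mem_remC] at hab hcd
      simp only [if_neg hab.2, if_neg hcd.2] at he
      exact Q.inj hab.1 hcd.1 he
    · intro k hk
      simp only [Finset.coe_Icc, Set.mem_Icc] at hk
      obtain ⟨a, b, hab, he⟩ := Q.surj hk.1 (show k ≤ μ.card by omega)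
      have hne : (a, b) ≠ (i, μ.rowLen i - 1) := by
        intro e
        simp only [Prod.mk.injEq] at e
        obtain ⟨rfl, rfl⟩ := e
        omega
      refine ⟨(a, b), ?_, ?_⟩
      · simp only [Finset.mem_coe, YoungDiagram.mem_cells, mem_remC]
        exact ⟨hab, hne⟩
      · simp only [if_neg hne]
        exact he

noncomputable def SYT.addCell {μ : YoungDiagram} (i : ℕ) (h : μ.rowLen (i + 1) < μ.rowLen i)
    (Q : SYT (remC μ i h)) : SYT μ where
  entry a b := if (a, b) = (i, μ.rowLen i - 1) then μ.card else Q.entry a b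
  entry_eq_zero a b hab := by
    rw [if_neg]
    · exact Q.entry_eq_zero a b (by rw [mem_remC]; tauto)
    · intro he
      simp only [Prod.mk.injEq] at he
      obtain ⟨rfl, rfl⟩ := he
      rw [yd_mem] at hab
      omega
  row_strict a b1 b2 hb hm := by
    have hc := remC_card μ i h
    rw [if_neg]
    · split_ifs with h1
      · have := Q.le_card a b1
        omega
      · exact Q.row_strict a b1 b2 hb ((mem_remC _ _ _ _ _).2 ⟨hm, h1⟩)
    · intro he
      simp only [Prod.mk.injEq] at he
      obtain ⟨rfl, rfl⟩ := he
      have := (yd_mem _ _ _).1 hm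
      omega
  col_strict a1 a2 b hb hm := by
    have hc := remC_card μ i h
    rw [if_neg]
    · split_ifs with h1
      · have := Q.le_card a1 b
        omega
      · exact Q.col_strict a1 a2 b hb ((mem_remC _ _ _ _ _).2 ⟨hm, h1⟩)
    · intro he
      simp only [Prod.mk.injEq] at he
      obtain ⟨rfl, rfl⟩ := he
      have := (yd_mem _ _ _).1 (μ.up_left_mem (show a1 + 1 ≤ a2 from hb) le_rfl hm)
      omega
  bijOn := by
    have hc := remC_card μ i h
    have hmem : (i, μ.rowLen i - 1) ∈ μ := by rw [yd_mem]; omega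
    refine ⟨?_, ?_, ?_⟩
    · rintro ⟨a, b⟩ hab
      simp only [Finset.mem_coe, YoungDiagram.mem_cells] at hab
      simp only [Finset.coe_Icc, Set.mem_Icc]
      split_ifs with h1
      · omega
      · have h1 := Q.pos a b ((mem_remC _ _ _ _ _).2 ⟨hab, h1⟩)
        have h2 := Q.le_card a b
        omega
    · rintro ⟨a, b⟩ hab ⟨c, d⟩ hcd he
      simp only [Finset.mem_coe, YoungDiagram.mem_cells] at hab hcd
      simp only at he
      have h2 := Q.le_card a b
      have h3 := Q.le_card c d
      split_ifs at he with h1 h2 h2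
      · rw [h1, h2]
      · omega
      · omega
      · exact Q.inj ((mem_remC _ _ _ _ _).2 ⟨hab, h1⟩) ((mem_remC _ _ _ _ _).2 ⟨hcd, h2⟩) he
    · intro k hk
      simp only [Finset.coe_Icc, Set.mem_Icc] at hk
      by_cases hk' : k = μ.card
      · refine ⟨(i, μ.rowLen i - 1), by simpa using hmem, ?_⟩
        simp [hk']
      · obtain ⟨a, b, hab, he⟩ := Q.surj hk.1 (show k ≤ _ by omega)
        rw [mem_remC] at hab
        refine ⟨(a, b), by simpa using hab.1, ?_⟩
        simp only [if_neg hab.2]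
        exact he

noncomputable def remEquiv {μ : YoungDiagram} (i m : ℕ) (h : μ.rowLen (i + 1) < μ.rowLen i)
    (hm : m < μ.card) :
    {Q : SYT μ // frow Q m ∧ Q.entry i (μ.rowLen i - 1) = μ.card} ≃
      {Q : SYT (remC μ i h) // frow Q m} where
  toFun Q := ⟨Q.1.rem i h Q.2.2, by
    intro k hk1 hk2
    obtain ⟨j, hj, he⟩ := Q.2.1 k hk1 hk2
    have hne : (0, j) ≠ (i, μ.rowLen i - 1) := by
      intro e
      simp only [Prod.mk.injEq] at e
      obtain ⟨rfl, rfl⟩ := e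
      have := Q.2.2
      omega
    refine ⟨j, (mem_remC _ _ _ _ _).2 ⟨hj, hne⟩, ?_⟩
    simp only [SYT.rem, if_neg hne]
    exact he⟩
  invFun Q := ⟨SYT.addCell i h Q.1, by
    intro k hk1 hk2
    obtain ⟨j, hj, he⟩ := Q.2 k hk1 hk2
    rw [mem_remC] at hj
    refine ⟨j, hj.1, ?_⟩
    simp only [SYT.addCell, if_neg hj.2]
    exact he, by simp [SYT.addCell]⟩
  left_inv Q := by
    apply Subtype.ext
    refine SYT.ext' fun a b => ?_
    simp only [SYT.addCell, SYT.rem]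
    split_ifs with h1
    · simp only [Prod.mk.injEq] at h1
      obtain ⟨rfl, rfl⟩ := h1
      exact Q.2.2.symm
    · rfl
  right_inv Q := by
    apply Subtype.ext
    refine SYT.ext' fun a b => ?_
    simp only [SYT.addCell, SYT.rem]
    split_ifs with h1
    · symm
      apply Q.1.entry_eq_zero
      rw [mem_remC]
      tauto
    · rfl

noncomputable def Gs (μ : YoungDiagram) (m : ℕ) : ℕ := Nat.card {Q : SYT μ // frow Q m}

lemma Gs_rec (μ : YoungDiagram) (k m : ℕ) (hk : μ.rowLen k = 0) (hm : m < μ.card) :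
    Gs μ m = ∑ i : Fin k, if h : μ.rowLen ((i : ℕ) + 1) < μ.rowLen i then Gs (remC μ i h) m
      else 0 := by
  have hrow : ∀ Q : SYT μ, ∃ i : Fin k, Q.entry i (μ.rowLen i - 1) = μ.card ∧
      μ.rowLen ((i : ℕ) + 1) < μ.rowLen i := by
    intro Q
    obtain ⟨a, b, hab, he⟩ := Q.surj (show 1 ≤ μ.card by omega) le_rfl
    obtain ⟨rfl, h2⟩ := Q.max_corner hab he
    have : a < k := by
      by_contra! hka
      have := μ.rowLen_anti k a hka
      omega
    exact ⟨⟨a, this⟩, he, h2⟩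
  have e : {Q : SYT μ // frow Q m} ≃ Σ i : Fin k, {Q : SYT μ // frow Q m ∧
      (Q.entry i (μ.rowLen i - 1) = μ.card ∧ μ.rowLen ((i : ℕ) + 1) < μ.rowLen i)} := by
    refine ⟨fun Q => ⟨(hrow Q.1).choose, Q.1, Q.2, (hrow Q.1).choose_spec⟩,
      fun p => ⟨p.2.1, p.2.2.1⟩, fun Q => rfl, ?_⟩
    rintro ⟨i, Q, hQ, he, hc⟩
    have h1 := (hrow Q).choose_spec
    have h2 : (hrow Q).choose = i := by
      have := Q.inj ((yd_mem _ _ _).2 (show μ.rowLen (hrow Q).choose - 1 < _ by omega))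
        ((yd_mem _ _ _).2 (show μ.rowLen i - 1 < _ by omega)) (h1.1.trans he.symm)
      simp only [Prod.mk.injEq] at this
      exact Fin.ext this.1
    simp only [Sigma.mk.injEq]
    refine ⟨h2, ?_⟩
    congr!
  unfold Gs
  rw [Nat.card_congr e, Nat.card_sigma]
  refine Finset.sum_congr rfl fun i _ => ?_
  split_ifs with h
  · rw [← Nat.card_congr (remEquiv i m h hm)]
    refine Nat.card_congr (Equiv.subtypeEquivRight fun Q => ?_)
    tauto
  · rw [Nat.card_eq_zero]
    left
    exact ⟨fun Q => h Q.2.2.2⟩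

/-- base case: all entries in the first row -/
lemma Gs_base_two (μ : YoungDiagram) (h : 0 < μ.rowLen 1) : Gs μ μ.card = 0 := by
  unfold Gs
  rw [Nat.card_eq_zero]
  left
  refine ⟨fun ⟨Q, hQ⟩ => ?_⟩
  have h1 : (1, 0) ∈ μ := (yd_mem _ _ _).2 h
  obtain ⟨j, hj, he⟩ := hQ _ (Q.pos 1 0 h1) (Q.le_card 1 0)
  have := Q.inj hj h1 he
  simp at this

lemma card_one_row (μ : YoungDiagram) (h : μ.rowLen 1 = 0) : μ.card = μ.rowLen 0 := by
  have : μ.cells = (Finset.range (μ.rowLen 0)).image (fun j => (0, j)) := by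
    ext ⟨a, b⟩
    simp only [YoungDiagram.mem_cells, yd_mem, Finset.mem_image, Finset.mem_range, Prod.mk.injEq]
    constructor
    · intro hb
      rcases Nat.eq_zero_or_pos a with rfl | ha
      · exact ⟨b, hb, rfl, rfl⟩
      · have := μ.rowLen_anti 1 a ha
        omega
    · rintro ⟨c, hc, rfl, rfl⟩
      exact hc
  show μ.cells.card = _
  rw [this, Finset.card_image_of_injective _ (fun a b hab => by simpa using hab)]
  simp

lemma Gs_base_one (μ : YoungDiagram) (h : μ.rowLen 1 = 0) : Gs μ μ.card = 1 := by
  have hc := card_one_row μ h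
  have hmem : ∀ a b, (a, b) ∈ μ ↔ a = 0 ∧ b < μ.card := by
    intro a b
    rw [yd_mem]
    rcases Nat.eq_zero_or_pos a with rfl | ha
    · simp [hc]
    · have := μ.rowLen_anti 1 a ha
      omega
  have huniq : ∀ Q : SYT μ, ∀ b, b < μ.card → Q.entry 0 b = b + 1 := by
    intro Q
    have lo : ∀ b, b < μ.card → b + 1 ≤ Q.entry 0 b := by
      intro b
      induction b with
      | zero => intro hb; exact Q.pos 0 0 ((hmem _ _).2 ⟨rfl, hb⟩)
      | succ b ih =>
        intro hb
        have := ih (by omega)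
        have := Q.row_strict 0 b (b+1) (by omega) ((hmem _ _).2 ⟨rfl, hb⟩)
        omega
    have hi : ∀ d b, b + d + 1 = μ.card → Q.entry 0 b ≤ b + 1 := by
      intro d
      induction d with
      | zero => intro b hb; have := Q.le_card 0 b; omega
      | succ d ih =>
        intro b hb
        have := ih (b+1) (by omega)
        have := Q.row_strict 0 b (b+1) (by omega) ((hmem _ _).2 ⟨rfl, by omega⟩)
        omega
    intro b hb
    exact le_antisymm (hi (μ.card - 1 - b) b (by omega)) (lo b hb)
  unfold Gs
  rw [Nat.card_eq_one_iff_unique]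
  refine ⟨⟨fun Q R => Subtype.ext (SYT.ext' fun a b => ?_)⟩, ⟨⟨⟨fun a b => if a = 0 ∧ b < μ.card then b + 1 else 0, ?_, ?_, ?_, ?_, ?_, ?_⟩, ?_⟩⟩⟩
  · by_cases hab : (a, b) ∈ μ
    · obtain ⟨rfl, hb⟩ := (hmem _ _).1 hab
      rw [huniq _ _ hb, huniq _ _ hb]
    · rw [Q.1.entry_eq_zero _ _ hab, R.1.entry_eq_zero _ _ hab]
  · intro i j hij
    rw [hmem] at hij
    simp [hij]
  · intro i j1 j2 hj hm
    rw [hmem] at hm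
    rw [if_pos ⟨hm.1, by omega⟩, if_pos hm]
    omega
  · intro i1 i2 j hj hm
    rw [hmem] at hm
    omega
  · rintro ⟨a, b⟩ hab
    simp only [Finset.mem_coe, YoungDiagram.mem_cells, hmem] at hab
    simp only [if_pos hab, Finset.coe_Icc, Set.mem_Icc]
    omega
  · rintro ⟨a, b⟩ hab ⟨c, d⟩ hcd he
    simp only [Finset.mem_coe, YoungDiagram.mem_cells, hmem] at hab hcd
    simp only [if_pos hab, if_pos hcd] at he
    simp only [Prod.mk.injEq]
    omega
  · intro k hk
    simp only [Finset.coe_Icc, Set.mem_Icc] at hk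
    refine ⟨(0, k - 1), ?_, ?_⟩
    · rw [Finset.mem_coe, YoungDiagram.mem_cells, hmem]
      exact ⟨rfl, by omega⟩
    · show (if 0 = 0 ∧ k - 1 < μ.card then k - 1 + 1 else 0) = k
      rw [if_pos ⟨rfl, by omega⟩]
      omega
  · intro k hk1 hk2
    refine ⟨k - 1, (hmem _ _).2 ⟨rfl, by omega⟩, ?_⟩
    show (if 0 = 0 ∧ k - 1 < μ.card then k - 1 + 1 else 0) = k
    rw [if_pos ⟨rfl, by omega⟩]
    omega

/-- Key identity: alternating sum equals tableau count. -/
lemma Fs_eq_Gs (k t : ℕ) : ∀ μ : YoungDiagram, μ.rowLen k = 0 → t ≤ μ.card →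
    Fs k t (fun i => ((μ.rowLen (i : ℕ) : ℕ) : ℤ) - ((i : ℕ) : ℤ)) = Gs μ (μ.card - t) := by
  induction t with
  | zero =>
    intro μ hk _
    rw [Nat.sub_zero]
    by_cases h : μ.rowLen 1 = 0
    · rw [Gs_base_one μ h, Fs_zero_one]
      · rfl
      · intro i hi; rw [hi]; simp
      · intro i hi
        have := μ.rowLen_anti 1 i (by omega)
        have : μ.rowLen i = 0 := by omega
        simp [this]
    · have hk2 : 1 < k := by
        by_contra! hle
        have := μ.rowLen_anti k 1 hle
        omega
      rw [Gs_base_two μ (by omega), Fs_zero_two k _ ⟨0, by omega⟩ ⟨1, hk2⟩]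
      · rfl
      · simp
      · simp
      · simp; omega
  | succ t ih =>
    intro μ hk ht
    rw [Fs_succ, Gs_rec μ k _ hk (by omega)]
    push_cast
    refine Finset.sum_congr rfl fun i _ => ?_
    split_ifs with h
    · have hc := remC_card μ i h
      rw [show μ.card - (t + 1) = (remC μ i h).card - t by omega, ← ih]
      · congr 1
        funext j
        rw [remC_rowLen]
        by_cases hj : j = i
        · subst hj
          simp only [if_true]
          omega
        · have : (j : ℕ) ≠ i := fun e => hj (Fin.ext e)
          simp [hj, this]
      · rw [remC_rowLen, if_neg (by have := i.2; omega), hk]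
      · omega
    · have hle := μ.rowLen_anti i (i+1) (by omega)
      by_cases hi : (i : ℕ) + 1 < k
      · refine Fs_eq _ _ _ i ⟨i + 1, hi⟩ ?_ ?_
        · intro e; have := congrArg Fin.val e; simp at this
        · have : (⟨i + 1, hi⟩ : Fin k) ≠ i := by
            intro e; have := congrArg Fin.val e; simp at this
          simp only [this, if_true, if_false]
          omega
      · have hi' : (i : ℕ) + 1 = k := by have := i.2; omega
        refine Fs_neg _ _ _ i ?_
        rw [hi'] at h hle
        simp
        omega


/-! ### Orbit counting -/

noncomputable def injFix (n t : ℕ) (g : Equiv.Perm (Fin n)) : ℕ :=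
  Nat.card {u : Fin t ↪ Fin n // ∀ i, g (u i) = u i}

def content {n k : ℕ} (c : Fin k → ℤ) (f : Fin n → Fin k) : Prop :=
  ∀ i, ((Nat.card {x : Fin n // f x = i} : ℕ) : ℤ) = c i

def BX (n k t : ℕ) (c : Fin k → ℤ) : Type :=
  (Fin t ↪ Fin n) × {f : Fin n → Fin k // content c f}

noncomputable instance (n k t : ℕ) (c : Fin k → ℤ) : Fintype (BX n k t c) :=
  inferInstanceAs (Fintype ((Fin t ↪ Fin n) × {f : Fin n → Fin k // content c f}))

lemma content_comp {n k : ℕ} (c : Fin k → ℤ) (f : Fin n → Fin k) (g : Equiv.Perm (Fin n))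
    (h : content c f) : content c (f ∘ g) := by
  intro i
  rw [← h i]
  congr 1
  exact Nat.card_congr (g.subtypeEquiv fun a => Iff.rfl)

noncomputable instance (n k t : ℕ) (c : Fin k → ℤ) : MulAction (Equiv.Perm (Fin n)) (BX n k t c) where
  smul g p := (p.1.trans g.toEmbedding, ⟨p.2.1 ∘ ⇑(g⁻¹), content_comp c _ g⁻¹ p.2.2⟩)
  one_smul p := rfl
  mul_smul g h p := by
    refine Prod.ext rfl (Subtype.ext ?_)
    show p.2.1 ∘ ⇑(g * h)⁻¹ = (p.2.1 ∘ ⇑h⁻¹) ∘ ⇑g⁻¹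
    rw [mul_inv_rev]
    rfl

lemma smul_def' {n k t : ℕ} {c : Fin k → ℤ} (g : Equiv.Perm (Fin n)) (p : BX n k t c) :
    g • p = (p.1.trans g.toEmbedding, ⟨p.2.1 ∘ ⇑(g⁻¹), content_comp c _ g⁻¹ p.2.2⟩) := rfl

lemma card_fixedBy' (n k t : ℕ) (c : Fin k → ℤ) (g : Equiv.Perm (Fin n)) :
    Nat.card (MulAction.fixedBy (BX n k t c) g) = injFix n t g * fixedYoungFns n k c g⁻¹ := by
  unfold injFix fixedYoungFns
  rw [← Nat.card_prod]
  refine Nat.card_congr ⟨fun p => (⟨p.1.1, ?_⟩, ⟨p.1.2.1, ?_, p.1.2.2⟩),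
    fun q => ⟨(q.1.1, ⟨q.2.1, q.2.2.2⟩), ?_⟩, fun p => rfl, fun q => rfl⟩
  · intro i
    have h := p.2
    rw [MulAction.mem_fixedBy, smul_def'] at h
    have := congrArg (fun q : BX n k t c => q.1 i) h
    exact this
  · intro x
    have h := p.2
    rw [MulAction.mem_fixedBy, smul_def'] at h
    have := congrArg (fun q : BX n k t c => q.2.1 x) h
    exact this
  · refine MulAction.mem_fixedBy.2 ?_
    refine Prod.ext ?_ (Subtype.ext ?_)
    · ext i
      exact congrArg Fin.val (q.1.2 i)
    · funext x
      exact q.2.2.1 x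

lemma exists_perm_of (n k t : ℕ) (u u' : Fin t ↪ Fin n) (f f' : Fin n → Fin k)
    (h : ∀ i, Nat.card {x // f x = i} = Nat.card {x // f' x = i})
    (hu : ∀ a, f (u a) = f' (u' a)) :
    ∃ g : Equiv.Perm (Fin n), (∀ a, g (u a) = u' a) ∧ ∀ x, f' (g x) = f x := by
  -- the combined labelling
  let lab : (Fin t ↪ Fin n) → (Fin n → Fin k) → Fin n → Fin t ⊕ Fin k := fun u f x =>
    if hx : ∃ a, u a = x then Sum.inl hx.choose else Sum.inr (f x)
  have lab1 : ∀ u f a, lab u f (u a) = Sum.inl a := by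
    intro u f a
    have hx : ∃ a', u a' = u a := ⟨a, rfl⟩
    simp only [lab, dif_pos hx]
    rw [u.injective hx.choose_spec]
  have lab1' : ∀ u f x a, lab u f x = Sum.inl a ↔ u a = x := by
    intro u f x a
    constructor
    · intro hl
      by_cases hx : ∃ a', u a' = x
      · simp only [lab, dif_pos hx, Sum.inl.injEq] at hl
        rw [← hl]
        exact hx.choose_spec
      · simp [lab, dif_neg hx] at hl
    · rintro rfl
      exact lab1 u f a
  have lab2' : ∀ u f x i, lab u f x = Sum.inr i ↔ f x = i ∧ ¬ ∃ a, u a = x := by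
    intro u f x i
    by_cases hx : ∃ a', u a' = x
    · simp [lab, dif_pos hx]
      intro; simpa using hx
    · simp only [lab, dif_neg hx, Sum.inr.injEq]
      tauto
  have cards : ∀ l, Nonempty ({x // lab u f x = l} ≃ {x // lab u' f' x = l}) := by
    rintro (a | i)
    · refine ⟨⟨fun _ => ⟨u' a, (lab1' _ _ _ _).2 rfl⟩, fun _ => ⟨u a, (lab1' _ _ _ _).2 rfl⟩, ?_, ?_⟩⟩
      · rintro ⟨x, hx⟩
        exact Subtype.ext ((lab1' _ _ _ _).1 hx)
      · rintro ⟨x, hx⟩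
        exact Subtype.ext ((lab1' _ _ _ _).1 hx)
    · have split : ∀ (u : Fin t ↪ Fin n) (f : Fin n → Fin k),
          (Finset.univ.filter fun x => lab u f x = Sum.inr i).card +
            (Finset.univ.filter fun a => f (u a) = i).card =
          (Finset.univ.filter fun x => f x = i).card := by
        intro u f
        rw [← Finset.card_map u, ← Finset.card_union_of_disjoint]
        · congr 1
          ext x
          simp only [Finset.mem_union, Finset.mem_filter, Finset.mem_univ, true_and,
            Finset.mem_map, lab2']
          constructor
          · rintro (h1 | ⟨a, h1, rfl⟩)
            · exact h1.1
            · exact h1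
          · intro hx
            by_cases he : ∃ a, u a = x
            · right
              obtain ⟨a, rfl⟩ := he
              exact ⟨a, hx, rfl⟩
            · exact Or.inl ⟨hx, he⟩
        · rw [Finset.disjoint_left]
          intro x hx hx'
          simp only [Finset.mem_filter, Finset.mem_univ, true_and, Finset.mem_map, lab2'] at hx hx'
          obtain ⟨a, _, rfl⟩ := hx'
          exact hx.2 ⟨a, rfl⟩
      have s1 := split u f
      have s2 := split u' f'
      have s3 := h i
      rw [Nat.card_eq_fintype_card, Nat.card_eq_fintype_card, Fintype.card_subtype,
        Fintype.card_subtype] at s3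
      have s4 : (Finset.univ.filter fun a => f (u a) = i) =
          (Finset.univ.filter fun a => f' (u' a) = i) := by
        ext a; simp [hu a]
      rw [s4] at s1
      refine ⟨Fintype.equivOfCardEq ?_⟩
      rw [Fintype.card_subtype, Fintype.card_subtype]
      omega
  let e : Equiv.Perm (Fin n) := Equiv.ofFiberEquiv (f := lab u f) (g := lab u' f')
    fun l => (cards l).some
  have he : ∀ x, lab u' f' (e x) = lab u f x := fun x => Equiv.ofFiberEquiv_map _ x
  have h1 : ∀ a, e (u a) = u' a := by
    intro a
    have := he (u a)
    rw [lab1, lab1'] at this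
    exact this.symm
  refine ⟨e, h1, fun x => ?_⟩
  by_cases hx : ∃ a, u a = x
  · obtain ⟨a, rfl⟩ := hx
    rw [h1, hu]
  · have h2 : lab u f x = Sum.inr (f x) := (lab2' _ _ _ _).2 ⟨rfl, hx⟩
    have := he x
    rw [h2, lab2'] at this
    exact this.1

lemma exists_fn_of (n k t : ℕ) (c : Fin k → ℤ) (hc : ∑ i, c i = n) (y : Fin t → Fin k)
    (hy : ∀ i, ((Finset.univ.filter fun a => y a = i).card : ℤ) ≤ c i) :
    ∃ (u : Fin t ↪ Fin n) (f : Fin n → Fin k), content c f ∧ ∀ a, f (u a) = y a := by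
  have hpos : ∀ i, 0 ≤ c i := fun i => le_trans (by positivity) (hy i)
  have hcard : Fintype.card (Fin n) = Fintype.card (Σ i : Fin k, Fin (c i).toNat) := by
    rw [Fintype.card_sigma]
    simp only [Fintype.card_fin]
    zify
    rw [← hc]
    exact Finset.sum_congr rfl fun i _ => (Int.toNat_of_nonneg (hpos i)).symm
  let e := Fintype.equivOfCardEq hcard
  have emb : ∀ i, Nonempty ({a // y a = i} ↪ Fin (c i).toNat) := by
    intro i
    rw [Function.Embedding.nonempty_iff_card_le, Fintype.card_subtype, Fintype.card_fin]
    have := hy i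
    omega
  refine ⟨⟨fun a => e.symm ⟨y a, (emb (y a)).some ⟨a, rfl⟩⟩, ?_⟩, fun x => (e x).1, ?_, ?_⟩
  · intro a b hab
    have h1 := e.symm.injective hab
    have h2 : y a = y b := congrArg Sigma.fst h1
    have h3 : ∀ i (ha : y a = i) (hb : y b = i), (⟨i, (emb i).some ⟨a, ha⟩⟩ : Σ i : Fin k, Fin (c i).toNat) =
        ⟨i, (emb i).some ⟨b, hb⟩⟩ → a = b := by
      intro i ha hb hh
      have := eq_of_heq (Sigma.mk.inj hh).2
      have := (emb i).some.injective this
      exact congrArg Subtype.val this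
    refine h3 (y b) h2 rfl ?_
    rw [← h1]
    clear h1 hab h3
    congr 1
    · exact h2.symm
    · have : ∀ i j (hi : y a = i) (hj : y a = j), HEq ((emb i).some ⟨a, hi⟩) ((emb j).some ⟨a, hj⟩) := by
        rintro i j rfl rfl; rfl
      exact this _ _ _ _
  · intro i
    have : {x : Fin n // (e x).1 = i} ≃ Fin (c i).toNat :=
      (e.subtypeEquiv (q := fun s => s.1 = i) fun x => Iff.rfl).trans ⟨fun s => Fin.cast (by rw [s.2]) s.1.2, fun x => ⟨⟨i, x⟩, rfl⟩,
        by rintro ⟨⟨j, x⟩, rfl⟩; rfl, fun x => rfl⟩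
    rw [Nat.card_congr this]
    simp [hpos i]
  · intro a
    show (e (e.symm _)).1 = y a
    rw [Equiv.apply_symm_apply]

lemma orbit_count (n k t : ℕ) (c : Fin k → ℤ) (hc : ∑ i, c i = n) :
    (Nat.card (MulAction.orbitRel.Quotient (Equiv.Perm (Fin n)) (BX n k t c)) : ℤ) = Nw k t c := by
  have hN : Nw k t c = Nat.card {y : Fin t → Fin k //
      ∀ i, ((Finset.univ.filter fun a => y a = i).card : ℤ) ≤ c i} := by
    unfold Nw
    rw [Nat.card_eq_fintype_card, Fintype.card_subtype, Finset.sum_boole]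
  rw [hN]
  congr 1
  have hle : ∀ p : BX n k t c, ∀ i,
      ((Finset.univ.filter fun a => (p.2.1 ∘ p.1) a = i).card : ℤ) ≤ c i := by
    rintro ⟨u, f, hf⟩ i
    rw [← hf i, Nat.card_eq_fintype_card, Fintype.card_subtype]
    rw [← Finset.card_map u]
    norm_cast
    refine Finset.card_le_card fun x hx => ?_
    simp only [Finset.mem_map, Finset.mem_filter, Finset.mem_univ, true_and] at hx ⊢
    obtain ⟨a, h, rfl⟩ := hx
    exact h
  refine Nat.card_congr (Equiv.ofBijective (Quotient.lift (fun p => ⟨p.2.1 ∘ p.1, hle p⟩) ?_) ⟨?_, ?_⟩)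
  · rintro p q hpq
    obtain ⟨g, rfl⟩ := (MulAction.orbitRel_apply.1 hpq)
    apply Subtype.ext
    funext a
    simp [smul_def']
  · intro p q
    induction p using Quotient.inductionOn with | _ p
    induction q using Quotient.inductionOn with | _ q
    intro h
    have h' : ∀ a, p.2.1 (p.1 a) = q.2.1 (q.1 a) := fun a =>
      congrFun (congrArg Subtype.val h) a
    obtain ⟨g, hg1, hg2⟩ := exists_perm_of n k t p.1 q.1 p.2.1 q.2.1
      (fun i => by have := (p.2.2 i).trans (q.2.2 i).symm; exact_mod_cast this) h'
    apply Quotient.sound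
    refine (MulAction.orbitRel _ _).symm ?_
    refine MulAction.orbitRel_apply.2 ⟨g, ?_⟩
    show g • p = q
    rw [smul_def']
    refine Prod.ext (by ext a; exact congrArg Fin.val (hg1 a)) (Subtype.ext ?_)
    funext x
    have := hg2 (g⁻¹ x)
    simpa using this.symm
  · rintro ⟨y, hy⟩
    obtain ⟨u, f, hf, hu⟩ := exists_fn_of n k t c hc y hy
    refine ⟨Quotient.mk _ (u, ⟨f, hf⟩), Subtype.ext ?_⟩
    funext a
    exact hu a

lemma burnside_sum (n k t : ℕ) (c : Fin k → ℤ) (hc : ∑ i, c i = n) :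
    ∑ g : Equiv.Perm (Fin n), (injFix n t g : ℤ) * (fixedYoungFns n k c g⁻¹ : ℤ) =
      Nw k t c * n.factorial := by
  have := MulAction.sum_card_fixedBy_eq_card_orbits_mul_card_group (Equiv.Perm (Fin n)) (BX n k t c)
  rw [← orbit_count n k t c hc, Nat.card_eq_fintype_card]
  rw [Fintype.card_perm, Fintype.card_fin] at this
  zify at this
  rw [← this]
  refine Finset.sum_congr rfl fun g _ => ?_
  rw [← Nat.card_eq_fintype_card]
  exact_mod_cast (card_fixedBy' n k t c g).symm

lemma sum_rowLens (μ : YoungDiagram) :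
    ∑ i : Fin μ.rowLens.length, (μ.rowLen (i : ℕ)) = μ.card := by
  have : μ.card = ∑ i ∈ Finset.range (μ.colLen 0), μ.rowLen i := by
    show μ.cells.card = _
    rw [Finset.card_eq_sum_card_fiberwise (f := Prod.fst) (t := Finset.range (μ.colLen 0))]
    · refine Finset.sum_congr rfl fun i _ => ?_
      rw [YoungDiagram.rowLen_eq_card]
      rfl
    · rintro ⟨a, b⟩ hab
      simp only [Finset.mem_coe, YoungDiagram.mem_cells, Finset.mem_range] at hab ⊢
      rw [← YoungDiagram.mem_iff_lt_colLen]
      exact μ.up_left_mem le_rfl (Nat.zero_le _) hab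
  rw [this, Finset.sum_range, YoungDiagram.length_rowLens]

lemma chi_sum (n t : ℕ) (μ : YoungDiagram) (hμ : μ.card = n) (ht : t ≤ n) :
    ∑ g : Equiv.Perm (Fin n), (injFix n t g : ℤ) * chi n μ g⁻¹ =
      (Gs μ (n - t) : ℤ) * n.factorial := by
  have hk : μ.rowLen μ.rowLens.length = 0 := by
    rw [YoungDiagram.length_rowLens]
    by_contra h
    have : (μ.colLen 0, 0) ∈ μ := (yd_mem _ _ _).2 (by omega)
    rw [YoungDiagram.mem_iff_lt_colLen] at this
    omega
  subst hμ
  rw [← Fs_eq_Gs _ t μ hk ht]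
  unfold Fs chi
  rw [Finset.sum_mul]
  simp_rw [Finset.mul_sum]
  rw [Finset.sum_comm]
  refine Finset.sum_congr rfl fun σ _ => ?_
  rw [mul_assoc, ← burnside_sum, Finset.mul_sum]
  · exact Finset.sum_congr rfl fun g _ => by ring
  · rw [Finset.sum_add_distrib, Finset.sum_sub_distrib]
    rw [Equiv.sum_comp σ (fun i => ((i : ℕ) : ℤ))]
    rw [← sum_rowLens μ]
    push_cast
    ring


/-! ### Permutations with prescribed descents and chains of sets -/

lemma mem_descentSet' {m : ℕ} (w : Equiv.Perm (Fin m)) (d : ℕ) :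
    d ∈ descentSet w ↔ ∃ (h1 : 1 ≤ d) (h2 : d < m), w ⟨d, h2⟩ < w ⟨d - 1, by omega⟩ := by
  unfold descentSet permApp
  simp only [Finset.mem_filter, Finset.mem_Icc, Nat.add_sub_cancel]
  constructor
  · rintro ⟨⟨h1, h2⟩, h3⟩
    have h4 : d < m := by omega
    refine ⟨h1, h4, ?_⟩
    rw [dif_pos h4, dif_pos (by omega)] at h3
    exact Fin.lt_def.2 (by omega)
  · rintro ⟨h1, h2, h3⟩
    refine ⟨by omega, ?_⟩
    rw [dif_pos h2, dif_pos (by omega)]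
    have := Fin.lt_def.1 h3
    omega

lemma lt_of_no_desc {m : ℕ} (w : Equiv.Perm (Fin m)) (d x : ℕ) (hx : x + (d + 1) < m)
    (h : ∀ s ∈ descentSet w, ¬ (x < s ∧ s ≤ x + (d + 1))) :
    w ⟨x, by omega⟩ < w ⟨x + (d + 1), hx⟩ := by
  have step : ∀ y (hy : y + 1 < m), x ≤ y → y + 1 ≤ x + (d + 1) → w ⟨y, by omega⟩ < w ⟨y + 1, hy⟩ := by
    intro y hy h1 h2
    have h3 : y + 1 ∉ descentSet w := fun hm => h _ hm ⟨by omega, by omega⟩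
    rw [mem_descentSet'] at h3
    push Not at h3
    have := h3 (by omega) hy
    simp only [Nat.add_sub_cancel] at this
    refine lt_of_le_of_ne this fun e => ?_
    have := congrArg Fin.val (w.injective e)
    simp at this
  induction d with
  | zero => exact step x hx le_rfl le_rfl
  | succ d ih =>
    refine lt_trans (ih (by omega) (fun s hs hh => h s hs ⟨hh.1, by omega⟩)
      (fun y hy h1 h2 => step y hy h1 (by omega))) (step (x + (d + 1)) hx (by omega) (by omega))

lemma lt_of_no_desc' {m : ℕ} (w : Equiv.Perm (Fin m)) (x y : Fin m) (hxy : x < y)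
    (h : ∀ s ∈ descentSet w, ¬ ((x : ℕ) < s ∧ s ≤ y)) : w x < w y := by
  obtain ⟨x, hx⟩ := x
  obtain ⟨y, hy⟩ := y
  obtain ⟨d, rfl⟩ : ∃ d, y = x + (d + 1) := ⟨y - x - 1, by simp at hxy; omega⟩
  exact lt_of_no_desc w d x hy h

def IsSetChain (t : ℕ) (T : Finset ℕ) (F : ℕ → Finset (Fin t)) : Prop :=
  (∀ s ∈ T, (F s).card = s) ∧ (∀ s, s ∉ T → F s = ∅) ∧
    ∀ s ∈ T, ∀ s' ∈ T, s ≤ s' → F s ⊆ F s'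

def permChain (t : ℕ) (T : Finset ℕ) (w : Equiv.Perm (Fin t)) (s : ℕ) : Finset (Fin t) :=
  if s ∈ T then Finset.univ.filter (fun v => (w.symm v : ℕ) < s) else ∅

lemma permChain_isSetChain (t : ℕ) (T : Finset ℕ) (hT : ∀ s ∈ T, s ≤ t) (w : Equiv.Perm (Fin t)) :
    IsSetChain t T (permChain t T w) := by
  refine ⟨fun s hs => ?_, fun s hs => ?_, fun s hs s' hs' h => ?_⟩
  · rw [permChain, if_pos hs]
    have : (Finset.univ.filter (fun v => (w.symm v : ℕ) < s)).card =
        (Finset.univ.filter (fun v : Fin t => (v : ℕ) < s)).card := by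
      rw [← Finset.card_map w.symm.toEmbedding]
      congr 1
      ext v
      simp
    rw [this, Fin.card_filter_val_lt]
    exact min_eq_right (hT s hs)
  · rw [permChain, if_neg hs]
  · rw [permChain, permChain, if_pos hs, if_pos hs']
    intro v hv
    simp only [Finset.mem_filter, Finset.mem_univ, true_and] at hv ⊢
    omega

noncomputable def phiF (t : ℕ) (T : Finset ℕ) (F : ℕ → Finset (Fin t)) (v : Fin t) : ℕ :=
  (T.filter fun s => v ∉ F s).card

lemma phiF_permChain (t : ℕ) (T : Finset ℕ) (w : Equiv.Perm (Fin t)) (x : Fin t) :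
    phiF t T (permChain t T w) (w x) = (T.filter fun s => s ≤ (x : ℕ)).card := by
  unfold phiF
  congr 1
  refine Finset.filter_congr fun s hs => ?_
  rw [permChain, if_pos hs]
  simp

lemma eq_sort_of_chain (t : ℕ) (T : Finset ℕ) (w : Equiv.Perm (Fin t)) (hw : descentSet w ⊆ T) :
    w = Tuple.sort (phiF t T (permChain t T w)) := by
  rw [Tuple.eq_sort_iff]
  constructor
  · intro x y hxy
    simp only [Function.comp, phiF_permChain]
    refine Finset.card_le_card fun s hs => ?_
    simp only [Finset.mem_filter] at hs ⊢
    have := Fin.le_def.1 hxy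
    exact ⟨hs.1, by omega⟩
  · intro x y hxy he
    rw [phiF_permChain, phiF_permChain] at he
    refine lt_of_no_desc' w x y hxy fun s hs hh => ?_
    have hsub : (T.filter fun s => s ≤ (x : ℕ)) ⊆ (T.filter fun s => s ≤ (y : ℕ)) := by
      intro s hs
      simp only [Finset.mem_filter] at hs ⊢
      have := Fin.lt_def.1 hxy
      exact ⟨hs.1, by omega⟩
    have heq := Finset.eq_of_subset_of_card_le hsub he.ge
    have : s ∈ T.filter fun s => s ≤ (y : ℕ) := Finset.mem_filter.2 ⟨hw hs, hh.2⟩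
    rw [← heq, Finset.mem_filter] at this
    omega

lemma permChain_bij (t : ℕ) (T : Finset ℕ) (hT : ∀ s ∈ T, s ≤ t) :
    Function.Bijective (fun w : {w : Equiv.Perm (Fin t) // descentSet w ⊆ T} =>
      (⟨permChain t T w.1, permChain_isSetChain t T hT w.1⟩ :
        {F : ℕ → Finset (Fin t) // IsSetChain t T F})) := by
  constructor
  · rintro ⟨w, hw⟩ ⟨w', hw'⟩ h
    have h' : permChain t T w = permChain t T w' := congrArg Subtype.val h
    apply Subtype.ext
    show w = w'
    rw [eq_sort_of_chain t T w hw, eq_sort_of_chain t T w' hw', h']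
  · rintro ⟨F, hF1, hF2, hF3⟩
    set w := Tuple.sort (phiF t T F) with hwdef
    have hmono : Monotone (phiF t T F ∘ w) := Tuple.monotone_sort _
    have hstab := (Tuple.eq_sort_iff.1 hwdef).2
    have hmem : ∀ s ∈ T, ∀ v, v ∈ F s ↔ phiF t T F v < (T.filter fun s' => s' ≤ s).card := by
      intro s hs v
      constructor
      · intro hv
        refine Finset.card_lt_card (Finset.ssubset_iff_of_subset ?_ |>.2 ⟨s, ?_, ?_⟩)
        · intro s' hs'
          simp only [Finset.mem_filter] at hs' ⊢
          refine ⟨hs'.1, ?_⟩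
          by_contra! hlt
          exact hs'.2 (hF3 s hs s' hs'.1 hlt.le hv)
        · simp [hs]
        · simp [hv]
      · intro hlt
        by_contra hv
        refine absurd hlt (not_lt.2 (Finset.card_le_card fun s' hs' => ?_))
        simp only [Finset.mem_filter] at hs' ⊢
        exact ⟨hs'.1, fun h' => hv (hF3 s' hs'.1 s hs hs'.2 h')⟩
    have hlow : ∀ s ∈ T, ∀ x y : Fin t, x ≤ y → w y ∈ F s → w x ∈ F s := by
      intro s hs x y hxy hy
      rw [hmem s hs] at hy ⊢
      exact lt_of_le_of_lt (hmono hxy) hy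
    have hiff : ∀ s ∈ T, ∀ x : Fin t, w x ∈ F s ↔ (x : ℕ) < s := by
      intro s hs
      have hc : (Finset.univ.filter fun x : Fin t => w x ∈ F s).card = s := by
        rw [← Finset.card_map w.toEmbedding]
        conv_rhs => rw [← hF1 s hs]
        congr 1
        ext v
        simp only [Finset.mem_map, Finset.mem_filter, Finset.mem_univ, true_and,
          Equiv.coe_toEmbedding]
        constructor
        · rintro ⟨x, hx, rfl⟩; exact hx
        · intro hv; exact ⟨w.symm v, by simpa using hv, by simp⟩
      have hc2 : (Finset.univ.filter fun x : Fin t => (x : ℕ) < s).card = s := by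
        rw [Fin.card_filter_val_lt]
        exact min_eq_right (hT s hs)
      intro x
      constructor
      · intro hx
        by_contra! hle
        have hsub : (Finset.univ.filter fun x : Fin t => (x : ℕ) < s) ⊂
            (Finset.univ.filter fun x : Fin t => w x ∈ F s) := by
          refine Finset.ssubset_iff_of_subset ?_ |>.2 ⟨x, by simpa using hx, by simpa using hle⟩
          intro y hy
          simp only [Finset.mem_filter, Finset.mem_univ, true_and] at hy ⊢
          exact hlow s hs y x (Fin.le_def.2 (by omega)) hx
        have := Finset.card_lt_card hsub
        omega
      · intro hlt
        by_contra hx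
        have hsub : (Finset.univ.filter fun x : Fin t => w x ∈ F s) ⊂
            (Finset.univ.filter fun x : Fin t => (x : ℕ) < s) := by
          refine Finset.ssubset_iff_of_subset ?_ |>.2 ⟨x, by simpa using hlt, by simpa using hx⟩
          intro y hy
          simp only [Finset.mem_filter, Finset.mem_univ, true_and] at hy ⊢
          by_contra! hle
          exact hx (hlow s hs x y (Fin.le_def.2 (by omega)) hy)
        have := Finset.card_lt_card hsub
        omega
    refine ⟨⟨w, ?_⟩, Subtype.ext ?_⟩
    · intro d hd
      obtain ⟨h1, h2, h3⟩ := (mem_descentSet' w d).1 hd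
      by_contra hdT
      have hlt : (⟨d - 1, by omega⟩ : Fin t) < ⟨d, h2⟩ := Fin.lt_def.2 (by simp; omega)
      refine absurd (hstab _ _ hlt ?_) (not_lt.2 h3.le)
      unfold phiF
      congr 1
      refine Finset.filter_congr fun s hs => not_congr ?_
      rw [hiff s hs, hiff s hs]
      have : s ≠ d := fun e => hdT (e ▸ hs)
      simp only
      omega
    · funext s
      show permChain t T w s = F s
      unfold permChain
      split_ifs with hs
      · ext v
        have := hiff s hs (w.symm v)
        simp only [Equiv.apply_symm_apply] at this
        simp [this]
      · exact (hF2 s hs).symm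

noncomputable def Aperm (t : ℕ) (T : Finset ℕ) : ℕ :=
  Nat.card {w : Equiv.Perm (Fin t) // descentSet w ⊆ T}

lemma card_setChain (t : ℕ) (T : Finset ℕ) (hT : ∀ s ∈ T, s ≤ t) :
    Nat.card {F : ℕ → Finset (Fin t) // IsSetChain t T F} = Aperm t T :=
  (Nat.card_congr (Equiv.ofBijective _ (permChain_bij t T hT))).symm


/-! ### Maximal chains of colored injective words -/

lemma exists_sublist_mid {α : Type*} {l₁ l₂ : List α} (h : l₁.Sublist l₂) :
    ∀ s, l₁.length ≤ s → s ≤ l₂.length → ∃ l, l₁.Sublist l ∧ l.Sublist l₂ ∧ l.length = s := by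
  induction h with
  | slnil => intro s _ h; exact ⟨[], by simp, by simp, by simp at h; simp [h]⟩
  | @cons l₁ l₂ a h ih =>
    intro s h1 h2
    by_cases hs : s ≤ l₂.length
    · obtain ⟨l, ha, hb, hc⟩ := ih s h1 hs
      exact ⟨l, ha, hb.cons a, hc⟩
    · simp only [List.length_cons] at h2
      exact ⟨a :: l₂, h.cons a, List.Sublist.refl _, by simp; omega⟩
  | @cons_cons l₁ l₂ a h ih =>
    intro s h1 h2
    simp only [List.length_cons] at h1 h2
    obtain ⟨l, ha, hb, hc⟩ := ih (s - 1) (by omega) (by omega)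
    exact ⟨a :: l, ha.cons_cons a, hb.cons_cons a, by simp; omega⟩

section chains

variable {n r : ℕ}

lemma cword_le {u v : CInjWord n r} : u ≤ v ↔ u.1.Sublist v.1 := Iff.rfl

lemma cword_len_le (u : CInjWord n r) : u.1.length ≤ n := by
  have := u.2.length_le_card
  simpa using this

lemma cword_between {u v : CInjWord n r} (h : u ≤ v) (s : ℕ) (h1 : u.1.length ≤ s)
    (h2 : s ≤ v.1.length) : ∃ x : CInjWord n r, u ≤ x ∧ x ≤ v ∧ x.1.length = s := by
  obtain ⟨l, ha, hb, hc⟩ := exists_sublist_mid h s h1 h2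
  exact ⟨⟨l, (hb.map Prod.fst).nodup v.2⟩, ha, hb, hc⟩

lemma cword_extend (u : CInjWord n r) : ∃ v : CInjWord n r, u ≤ v ∧ v.1.length = n := by
  let A : Finset (Fin n) := (u.1.map Prod.fst).toFinset
  have hA : A.card = u.1.length := by
    rw [List.toFinset_card_of_nodup u.2]; simp
  refine ⟨⟨u.1 ++ (Aᶜ.toList.map fun i => (i, (0 : ZMod r))), ?_⟩, ?_, ?_⟩
  · rw [List.map_append, List.nodup_append']
    refine ⟨u.2, ?_, ?_⟩
    · rw [List.map_map]
      simpa [Function.comp_def] using Aᶜ.nodup_toList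
    · intro x hx hx'
      rw [List.map_map] at hx'
      simp only [Function.comp_def, List.map_id', Finset.mem_toList, Finset.mem_compl] at hx'
      exact hx' (List.mem_toFinset.2 hx)
  · exact List.sublist_append_left _ _
  · simp only [List.length_append, List.length_map, Finset.length_toList, Finset.card_compl,
      Fintype.card_fin, hA]
    have := cword_len_le u
    omega

lemma cword_extend' (u : CInjWord n r) (s : ℕ) (h1 : u.1.length ≤ s) (h2 : s ≤ n) :
    ∃ v : CInjWord n r, u ≤ v ∧ v.1.length = s := by
  obtain ⟨v, hv, hl⟩ := cword_extend u
  obtain ⟨x, hx, _, hxl⟩ := cword_between hv s h1 (by omega)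
  exact ⟨x, hx, hxl⟩

lemma chain_le {C : Set (WithTop (CInjWord n r))} (hC : IsChain (· ≤ ·) C) {u v : CInjWord n r}
    (hu : (u : WithTop (CInjWord n r)) ∈ C) (hv : (v : WithTop (CInjWord n r)) ∈ C)
    (hl : u.1.length ≤ v.1.length) : u ≤ v := by
  rcases hC.total hu hv with h | h
  · exact WithTop.coe_le_coe.1 h
  · have h' : v.1.Sublist u.1 := WithTop.coe_le_coe.1 h
    have : v = u := Subtype.ext (h'.eq_of_length_le hl)
    rw [this]

lemma chain_eq {C : Set (WithTop (CInjWord n r))} (hC : IsChain (· ≤ ·) C) {u v : CInjWord n r}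
    (hu : (u : WithTop (CInjWord n r)) ∈ C) (hv : (v : WithTop (CInjWord n r)) ∈ C)
    (hl : u.1.length = v.1.length) : u = v :=
  le_antisymm (chain_le hC hu hv hl.le) (chain_le hC hv hu hl.ge)

lemma max_insert {P : Type*} [Preorder P] {A C : Set P} (hC : C ∈ maxChainsIn A) {x : P}
    (hx : x ∈ A) (h : ∀ y ∈ C, x ≤ y ∨ y ≤ x) : x ∈ C := by
  have := hC.2.2 (insert x C) (Set.insert_subset hx hC.1)
    (hC.2.1.insert fun y hy _ => h y hy) (Set.subset_insert _ _)
  rw [this]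
  exact Set.mem_insert _ _

lemma max_bot {T : Finset ℕ} {C : Set (WithTop (CInjWord n r))}
    (hC : C ∈ maxChainsIn (rankSel (rkC n r) T)) : ⊥ ∈ C :=
  max_insert hC (by simp [rankSel]) fun _ _ => Or.inl bot_le

lemma max_top {T : Finset ℕ} {C : Set (WithTop (CInjWord n r))}
    (hC : C ∈ maxChainsIn (rankSel (rkC n r) T)) : ⊤ ∈ C :=
  max_insert hC (by simp [rankSel]) fun _ _ => Or.inr le_top

lemma max_exists {T : Finset ℕ} (hT : ∀ s ∈ T, s ≤ n) {C : Set (WithTop (CInjWord n r))}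
    (hC : C ∈ maxChainsIn (rankSel (rkC n r) T)) {s : ℕ} (hs : s ∈ T) :
    ∃ u : CInjWord n r, (u : WithTop (CInjWord n r)) ∈ C ∧ u.1.length = s := by
  -- largest word of length at most s
  have h0 : ∃ u : CInjWord n r, (u : WithTop (CInjWord n r)) ∈ C ∧ u.1.length ≤ s ∧
      ∀ v : CInjWord n r, (v : WithTop (CInjWord n r)) ∈ C → v.1.length ≤ s → v ≤ u := by
    let p : ℕ → Prop := fun m => ∃ u : CInjWord n r, (u : WithTop (CInjWord n r)) ∈ C ∧ u.1.length = m
    have hp0 : p 0 := ⟨⊥, max_bot hC, rfl⟩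
    have h1 := Nat.findGreatest_spec (P := p) (Nat.zero_le s) hp0
    obtain ⟨u, hu, hl⟩ := h1
    refine ⟨u, hu, by rw [hl]; exact Nat.findGreatest_le s, fun v hv hvl => ?_⟩
    refine chain_le hC.2.1 hv hu ?_
    rw [hl]
    exact Nat.le_findGreatest hvl ⟨v, hv, rfl⟩
  obtain ⟨lo, hlo, hlos, hlomax⟩ := h0
  have h1 : ∃ x : CInjWord n r, lo ≤ x ∧ x.1.length = s ∧
      ∀ v : CInjWord n r, (v : WithTop (CInjWord n r)) ∈ C → s ≤ v.1.length → x ≤ v := by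
    by_cases hex : ∃ m, ∃ v : CInjWord n r, (v : WithTop (CInjWord n r)) ∈ C ∧ s ≤ v.1.length ∧
        v.1.length = m
    · obtain ⟨hi, hhi, hhis, hhil⟩ := Nat.find_spec hex
      obtain ⟨x, hx1, hx2, hx3⟩ := cword_between
        (chain_le hC.2.1 hlo hhi (hlos.trans hhis)) s hlos hhis
      refine ⟨x, hx1, hx3, fun v hv hvs => hx2.trans (chain_le hC.2.1 hhi hv ?_)⟩
      rw [hhil]
      exact Nat.find_min' hex ⟨v, hv, hvs, rfl⟩
    · obtain ⟨x, hx, hxl⟩ := cword_extend' lo s hlos (hT s hs)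
      exact ⟨x, hx, hxl, fun v hv hvs => absurd ⟨_, v, hv, hvs, rfl⟩ hex⟩
  obtain ⟨x, hx1, hx2, hx3⟩ := h1
  refine ⟨x, max_insert hC ?_ ?_, hx2⟩
  · left
    show x.1.length ∈ T
    rw [hx2]; exact hs
  · intro y hy
    induction y using WithTop.recTopCoe with
    | top => exact Or.inl le_top
    | coe v =>
      rcases le_total s v.1.length with h | h
      · exact Or.inl (WithTop.coe_le_coe.2 (hx3 v hy h))
      · exact Or.inr (WithTop.coe_le_coe.2 ((hlomax v hy h).trans hx1))

lemma max_of_complete {T : Finset ℕ} {C : Set (WithTop (CInjWord n r))}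
    (hsub : C ⊆ rankSel (rkC n r) T) (hch : IsChain (· ≤ ·) C) (hb : ⊥ ∈ C) (ht : ⊤ ∈ C)
    (hex : ∀ s ∈ T, ∃ u : CInjWord n r, (u : WithTop (CInjWord n r)) ∈ C ∧ u.1.length = s) :
    C ∈ maxChainsIn (rankSel (rkC n r) T) := by
  refine ⟨hsub, hch, fun D hD hDch hCD => Set.Subset.antisymm hCD fun x hx => ?_⟩
  induction x using WithTop.recTopCoe with
  | top => exact ht
  | coe v =>
    rcases hD hx with h | h | h
    · obtain ⟨u, hu, hl⟩ := hex _ h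
      have : u = v := chain_eq hDch (hCD hu) hx hl
      exact this ▸ hu
    · rw [h]; exact hb
    · exact absurd h (WithTop.coe_ne_top)

/-- the subword of `(u, c)` at the positions in `A` -/
def wordL {t : ℕ} (u : Fin t ↪ Fin n) (c : Fin t → ZMod r) (A : Finset (Fin t)) :
    List (Fin n × ZMod r) :=
  ((List.finRange t).filter (fun i => decide (i ∈ A))).map (fun i => (u i, c i))

noncomputable def wordC {t : ℕ} (u : Fin t ↪ Fin n) (c : Fin t → ZMod r) (A : Finset (Fin t)) :
    CInjWord n r :=
  ⟨wordL u c A, by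
    unfold wordL
    rw [List.map_map]
    exact List.Nodup.map u.injective ((List.nodup_finRange t).filter _)⟩

lemma wordC_len {t : ℕ} (u : Fin t ↪ Fin n) (c : Fin t → ZMod r) (A : Finset (Fin t)) :
    (wordC u c A).1.length = A.card := by
  show (wordL u c A).length = _
  unfold wordL
  rw [List.length_map, ← List.toFinset_card_of_nodup ((List.nodup_finRange t).filter _)]
  congr 1
  ext i
  simp

lemma wordC_mono {t : ℕ} (u : Fin t ↪ Fin n) (c : Fin t → ZMod r) {A B : Finset (Fin t)}
    (h : A ⊆ B) : wordC u c A ≤ wordC u c B := by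
  refine List.Sublist.map _ ?_
  refine List.monotone_filter_right _ ?_
  intro i hi
  simp only [decide_eq_true_eq] at hi ⊢
  exact h hi

lemma mem_wordC {t : ℕ} (u : Fin t ↪ Fin n) (c : Fin t → ZMod r) (A : Finset (Fin t)) (i : Fin t) :
    (u i, c i) ∈ (wordC u c A).1 ↔ i ∈ A := by
  show (u i, c i) ∈ wordL u c A ↔ _
  unfold wordL
  simp only [List.mem_map, List.mem_filter, List.mem_finRange, true_and, decide_eq_true_eq,
    Prod.mk.injEq]
  constructor
  · rintro ⟨j, hj, he, _⟩
    rw [← u.injective he]; exact hj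
  · intro h; exact ⟨i, h, rfl, rfl⟩

lemma wordC_inj {t : ℕ} (u : Fin t ↪ Fin n) (c : Fin t → ZMod r) {A B : Finset (Fin t)}
    (h : wordC u c A = wordC u c B) : A = B := by
  ext i
  rw [← mem_wordC u c, h, mem_wordC]

lemma wordC_univ {t : ℕ} (u : Fin t ↪ Fin n) (c : Fin t → ZMod r) :
    (wordC u c Finset.univ).1 = List.ofFn (fun i => (u i, c i)) := by
  show wordL u c Finset.univ = _
  unfold wordL
  simp [List.ofFn_eq_map]

lemma wordC_sub {t : ℕ} (u : Fin t ↪ Fin n) (c : Fin t → ZMod r) (v : CInjWord n r)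
    (h : v ≤ wordC u c Finset.univ) : ∃ A, v = wordC u c A := by
  have h' : v.1.Sublist ((List.finRange t).map (fun i => (u i, c i))) := by
    have := cword_le.1 h
    rwa [wordC_univ, List.ofFn_eq_map] at this
  obtain ⟨l, hl, he⟩ := List.sublist_map_iff.1 h'
  refine ⟨l.toFinset, Subtype.ext ?_⟩
  show v.1 = wordL u c _
  rw [he]
  unfold wordL
  congr 1
  have hsub : ∀ (L l : List (Fin t)), L.Nodup → l.Sublist L →
      l = L.filter (fun i => decide (i ∈ l.toFinset)) := by
    intro L l hL hsl
    refine List.Sublist.eq_of_length_le ?_ ?_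
    · have h1 := hsl.filter (fun i => decide (i ∈ l.toFinset))
      have h2 : l.filter (fun i => decide (i ∈ l.toFinset)) = l := by
        rw [List.filter_eq_self]
        intro a ha
        simpa using ha
      rwa [h2] at h1
    · rw [← List.toFinset_card_of_nodup (hL.filter _),
        ← List.toFinset_card_of_nodup (hsl.nodup hL)]
      refine Finset.card_le_card fun i hi => ?_
      simp at hi ⊢
      exact hi.2
  exact hsub _ l (List.nodup_finRange t) hl

lemma permC_wordC {t : ℕ} (u : Fin t ↪ Fin n) (c : Fin t → ZMod r) (A : Finset (Fin t))
    (g : Equiv.Perm (Fin n)) (hg : ∀ i, g (u i) = u i) : permCWord g (wordC u c A) = wordC u c A := by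
  apply Subtype.ext
  show (wordL u c A).map _ = wordL u c A
  unfold wordL
  rw [List.map_map]
  refine List.map_congr_left fun i _ => ?_
  simp [hg]

end chains


section chains2

variable {n r : ℕ}

def chainSet {t : ℕ} (T : Finset ℕ) (F : ℕ → Finset (Fin t)) (u : Fin t ↪ Fin n)
    (c : Fin t → ZMod r) : Set (WithTop (CInjWord n r)) :=
  {x | ∃ s ∈ T, x = ((wordC u c (F s) : CInjWord n r) : WithTop (CInjWord n r))} ∪ {⊥, ⊤}

lemma chainSet_max {t : ℕ} {T : Finset ℕ} {F : ℕ → Finset (Fin t)}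
    (hF : IsSetChain t T F) (u : Fin t ↪ Fin n) (c : Fin t → ZMod r) :
    chainSet T F u c ∈ maxChainsIn (rankSel (rkC n r) T) := by
  refine max_of_complete ?_ ?_ ?_ ?_ ?_
  · rintro x (⟨s, hs, rfl⟩ | hx)
    · left
      show (wordC u c (F s)).1.length ∈ T
      rw [wordC_len, hF.1 s hs]; exact hs
    · exact Or.inr hx
  · rintro x hx y hy -
    rcases hx with ⟨s, hs, rfl⟩ | rfl | rfl
    · rcases hy with ⟨s', hs', rfl⟩ | rfl | rfl
      · rcases le_total s s' with h | h
        · left; exact WithTop.coe_le_coe.2 (wordC_mono u c (hF.2.2 s hs s' hs' h))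
        · right; exact WithTop.coe_le_coe.2 (wordC_mono u c (hF.2.2 s' hs' s hs h))
      · right; exact bot_le
      · left; exact le_top
    · left; exact bot_le
    · right; exact le_top
  · right; left; rfl
  · right; right; rfl
  · intro s hs
    exact ⟨_, Or.inl ⟨s, hs, rfl⟩, by rw [wordC_len, hF.1 s hs]⟩

lemma chainSet_word {t : ℕ} {T : Finset ℕ} (hT0 : 0 ∉ T) {F : ℕ → Finset (Fin t)}
    (hF : IsSetChain t T F) (u : Fin t ↪ Fin n) (c : Fin t → ZMod r) {s : ℕ} (hs : s ∈ T)
    (v : CInjWord n r) (hv : (v : WithTop (CInjWord n r)) ∈ chainSet T F u c)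
    (hl : v.1.length = s) : v = wordC u c (F s) := by
  exact chain_eq (chainSet_max hF u c).2.1 hv (Or.inl ⟨s, hs, rfl⟩)
    (by rw [hl, wordC_len, hF.1 s hs])

lemma chainSet_fixed {t : ℕ} {T : Finset ℕ} (F : ℕ → Finset (Fin t))
    (u : Fin t ↪ Fin n) (c : Fin t → ZMod r) (g : Equiv.Perm (Fin n)) (hg : ∀ i, g (u i) = u i) :
    (WithTop.map (permCWord g)) '' (chainSet T F u c) = chainSet T F u c := by
  have hfix : ∀ x ∈ chainSet T F u c, WithTop.map (permCWord g) x = x := by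
    rintro x (⟨s, hs, rfl⟩ | rfl | rfl)
    · rw [WithTop.map_coe, permC_wordC u c _ g hg]
    · rfl
    · rfl
  rw [Set.image_congr hfix]
  simp

lemma alpha_count (T : Finset ℕ) (hT : T ⊆ Finset.Icc 1 n) (hr : 0 < r) (g : Equiv.Perm (Fin n)) :
    cAlpha n r T g = (Aperm (T.sup id) T : ℤ) * (r : ℤ) ^ (T.sup id) * (injFix n (T.sup id) g : ℤ) := by
  haveI : NeZero r := ⟨hr.ne'⟩
  set t := T.sup id with ht
  have hTt : ∀ s ∈ T, s ≤ t := fun s hs => Finset.le_sup (f := id) hs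
  have hT0 : 0 ∉ T := fun h => by have := hT h; simp at this
  have hTn : ∀ s ∈ T, s ≤ n := fun s hs => (Finset.mem_Icc.1 (hT hs)).2
  have htn : t ≤ n := Finset.sup_le hTn
  have htT : t = 0 ∨ t ∈ T := by
    rcases T.eq_empty_or_nonempty with h | h
    · left; rw [ht, h]; rfl
    · right
      obtain ⟨s, hs, he⟩ := Finset.exists_mem_eq_sup T h id
      rw [ht, he]; exact hs
  let Y := {F : ℕ → Finset (Fin t) // IsSetChain t T F} ×
    (Fin t → ZMod r) × {u : Fin t ↪ Fin n // ∀ i, g (u i) = u i}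
  let X := {C : Set (WithTop (CInjWord n r)) // C ∈ maxChainsIn (rankSel (rkC n r) T) ∧
    (WithTop.map (permCWord g)) '' C = C}
  let Φ : Y → X := fun y => ⟨chainSet T y.1.1 y.2.2.1 y.2.1, chainSet_max y.1.2 _ _,
    chainSet_fixed _ _ _ g y.2.2.2⟩
  have hinj : Function.Injective Φ := by
    rintro ⟨⟨F, hF⟩, c, ⟨u, hu⟩⟩ ⟨⟨F', hF'⟩, c', ⟨u', hu'⟩⟩ h
    have h' : chainSet T F u c = chainSet T F' u' c' := congrArg Subtype.val h
    have hw : ∀ s ∈ T, wordC u c (F s) = wordC u' c' (F' s) := by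
      intro s hs
      refine chainSet_word hT0 hF' u' c' hs _ ?_ (by rw [wordC_len, hF.1 s hs])
      rw [← h']
      exact Or.inl ⟨s, hs, rfl⟩
    have huc : ∀ i, u i = u' i ∧ c i = c' i := by
      intro i
      have htT' : t ∈ T := by
        rcases htT with h0 | h0
        · exact absurd i.2 (by omega)
        · exact h0
      have e1 : F t = Finset.univ := by
        rw [← Finset.card_eq_iff_eq_univ, hF.1 t htT', Fintype.card_fin]
      have e2 : F' t = Finset.univ := by
        rw [← Finset.card_eq_iff_eq_univ, hF'.1 t htT', Fintype.card_fin]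
      have := congrArg Subtype.val (hw t htT')
      rw [e1, e2, wordC_univ, wordC_univ] at this
      have := congrFun (List.ofFn_injective this) i
      simpa using this
    obtain rfl : u = u' := by ext i; exact congrArg Fin.val (huc i).1
    obtain rfl : c = c' := by funext i; exact (huc i).2
    obtain rfl : F = F' := by
      funext s
      by_cases hs : s ∈ T
      · exact wordC_inj u c (hw s hs)
      · rw [hF.2.1 s hs, hF'.2.1 s hs]
    rfl
  have hsurj : Function.Surjective Φ := by
    rintro ⟨C, hC, hg⟩
    have hfixw : ∀ v : CInjWord n r, (v : WithTop (CInjWord n r)) ∈ C → permCWord g v = v := by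
      intro v hv
      refine chain_eq hC.2.1 ?_ hv ?_
      · rw [← hg]
        exact ⟨v, hv, rfl⟩
      · show (v.1.map _).length = _
        simp
    -- the top word
    obtain ⟨W, hWC, hWl⟩ : ∃ W : CInjWord n r, (W : WithTop (CInjWord n r)) ∈ C ∧ W.1.length = t := by
      rcases htT with h | h
      · exact ⟨⊥, max_bot hC, h.symm⟩
      · exact max_exists hTn hC h
    let f : Fin t → Fin n × ZMod r := fun i => W.1.get (Fin.cast hWl.symm i)
    have hf : W.1 = List.ofFn f := by
      refine List.ext_get (by simp [hWl]) ?_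
      intro i h1 h2
      simp [f]
    have hfinj : Function.Injective (fun i => (f i).1) := by
      have := W.2
      rw [hf, List.map_ofFn, List.nodup_ofFn] at this
      exact this
    let u : Fin t ↪ Fin n := ⟨fun i => (f i).1, hfinj⟩
    let c : Fin t → ZMod r := fun i => (f i).2
    have hWu : W = wordC u c Finset.univ := by
      apply Subtype.ext
      rw [wordC_univ, hf]
      rfl
    have hgu : ∀ i, g (u i) = u i := by
      intro i
      have := congrArg Subtype.val (hfixw W hWC)
      have h2 : (W.1.map (fun p => (g p.1, p.2))) = W.1 := this
      rw [hf, List.map_ofFn] at h2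
      have := congrFun (List.ofFn_injective h2) i
      exact congrArg Prod.fst this
    have hA : ∀ s, ∃ A : Finset (Fin t), (s ∈ T → ((wordC u c A : CInjWord n r) : WithTop (CInjWord n r)) ∈ C ∧ A.card = s) ∧
        (s ∉ T → A = ∅) := by
      intro s
      by_cases hs : s ∈ T
      · obtain ⟨v, hv, hvl⟩ := max_exists hTn hC hs
        have hle : v ≤ W := chain_le hC.2.1 hv hWC (by rw [hvl, hWl]; exact hTt s hs)
        rw [hWu] at hle
        obtain ⟨A, rfl⟩ := wordC_sub u c v hle
        rw [wordC_len] at hvl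
        exact ⟨A, fun _ => ⟨hv, hvl⟩, fun h => absurd hs h⟩
      · exact ⟨∅, fun h => absurd h hs, fun _ => rfl⟩
    choose F hF1 hF2 using hA
    have hF : IsSetChain t T F := by
      refine ⟨fun s hs => (hF1 s hs).2, hF2, fun s hs s' hs' hle => ?_⟩
      have := chain_le hC.2.1 (hF1 s hs).1 (hF1 s' hs').1
        (by rw [wordC_len, wordC_len, (hF1 s hs).2, (hF1 s' hs').2]; exact hle)
      intro i hi
      rw [← mem_wordC u c] at hi ⊢
      exact (cword_le.1 this).subset hi
    refine ⟨(⟨F, hF⟩, c, ⟨u, hgu⟩), Subtype.ext ?_⟩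
    show chainSet T F u c = C
    refine (chainSet_max hF u c).2.2 C hC.1 hC.2.1 ?_
    rintro x (⟨s, hs, rfl⟩ | rfl | rfl)
    · exact (hF1 s hs).1
    · exact max_bot hC
    · exact max_top hC
  have hcard : Nat.card X = Nat.card Y := (Nat.card_congr (Equiv.ofBijective Φ ⟨hinj, hsurj⟩)).symm
  have : cAlpha n r T g = (Nat.card X : ℤ) := rfl
  rw [this, hcard, Nat.card_prod, Nat.card_prod, card_setChain t T hTt]
  rw [Nat.card_fun, Nat.card_zmod]
  unfold injFix
  push_cast
  rw [Nat.card_eq_fintype_card, Fintype.card_fin]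
  ring

end chains2


/-! ### The longest permutation with a given descent set -/

lemma exists_block_perm (n : ℕ) (S : Finset ℕ) :
    ∃ w : Equiv.Perm (Fin n), ∀ x y : Fin n, x < y →
      (w y < w x ↔ ∃ s ∈ S, (x : ℕ) < s ∧ s ≤ y) := by
  set key : Fin n → ℕ := fun x => (S.filter (fun s => (x : ℕ) < s)).card * n + x with hkey
  have hk : ∀ x y : Fin n, x < y → ((∃ s ∈ S, (x : ℕ) < s ∧ s ≤ y) → key y < key x) ∧
      ((¬ ∃ s ∈ S, (x : ℕ) < s ∧ s ≤ y) → key x < key y) := by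
    intro x y hxy
    have hxy' := Fin.lt_def.1 hxy
    have hsub : (S.filter (fun s => (y : ℕ) < s)) ⊆ (S.filter (fun s => (x : ℕ) < s)) := by
      intro s hs
      simp only [Finset.mem_filter] at hs ⊢
      exact ⟨hs.1, by omega⟩
    constructor
    · rintro ⟨s, hs, h1, h2⟩
      have hc : (S.filter (fun s => (y : ℕ) < s)).card < (S.filter (fun s => (x : ℕ) < s)).card := by
        refine Finset.card_lt_card ⟨hsub, fun h => ?_⟩
        have := h (Finset.mem_filter.2 ⟨hs, h1⟩)
        simp only [Finset.mem_filter] at this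
        omega
      have hy := y.2
      have := Nat.mul_le_mul_right n (Nat.succ_le_of_lt hc)
      rw [Nat.succ_mul] at this
      simp only [hkey]
      omega
    · intro h
      have he : (S.filter (fun s => (y : ℕ) < s)) = (S.filter (fun s => (x : ℕ) < s)) := by
        refine Finset.Subset.antisymm hsub fun s hs => ?_
        simp only [Finset.mem_filter] at hs ⊢
        refine ⟨hs.1, ?_⟩
        by_contra hc
        exact h ⟨s, hs.1, hs.2, by omega⟩
      simp only [hkey, he]
      omega
  have hinj : Function.Injective key := by
    intro x y hxy
    by_contra hne
    rcases lt_or_gt_of_ne hne with h | h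
    · by_cases hh : ∃ s ∈ S, (x : ℕ) < s ∧ s ≤ y
      · have := (hk x y h).1 hh; omega
      · have := (hk x y h).2 hh; omega
    · by_cases hh : ∃ s ∈ S, (y : ℕ) < s ∧ s ≤ x
      · have := (hk y x h).1 hh; omega
      · have := (hk y x h).2 hh; omega
  have hsm : StrictMono (key ∘ Tuple.sort key) :=
    (Tuple.monotone_sort key).strictMono_of_injective (hinj.comp (Equiv.injective _))
  refine ⟨(Tuple.sort key).symm, fun x y hxy => ?_⟩
  rw [← hsm.lt_iff_lt]
  simp only [Function.comp, Equiv.apply_symm_apply]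
  constructor
  · intro h
    by_contra hh
    have := (hk x y hxy).2 hh
    omega
  · exact (hk x y hxy).1

lemma wS_inv {n : ℕ} (S : Finset ℕ) (hS : S ⊆ Finset.Icc 1 (n - 1))
    (wS : Equiv.Perm (Fin n)) (hwS : descentSet wS = S)
    (hwSmax : ∀ v : Equiv.Perm (Fin n), descentSet v = S → invCount v ≤ invCount wS)
    (x y : Fin n) (hxy : x < y) : wS y < wS x ↔ ∃ s ∈ S, (x : ℕ) < s ∧ s ≤ y := by
  obtain ⟨w0, hw0⟩ := exists_block_perm n S
  have hd : descentSet w0 = S := by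
    ext d
    rw [mem_descentSet']
    constructor
    · rintro ⟨h1, h2, h3⟩
      obtain ⟨s, hs, h4, h5⟩ := (hw0 _ _ (Fin.lt_def.2 (by simp; omega))).1 h3
      simp only at h4 h5
      have : s = d := by omega
      rwa [← this]
    · intro hd
      have := Finset.mem_Icc.1 (hS hd)
      refine ⟨this.1, by omega, (hw0 _ _ (Fin.lt_def.2 (by simp; omega))).2 ⟨d, hd, ?_, le_rfl⟩⟩
      simp only
      omega
  have hsub : (Finset.univ.filter fun p : Fin n × Fin n => p.1 < p.2 ∧ wS p.2 < wS p.1) ⊆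
      (Finset.univ.filter fun p : Fin n × Fin n => p.1 < p.2 ∧ w0 p.2 < w0 p.1) := by
    rintro ⟨a, b⟩ h
    simp only [Finset.mem_filter, Finset.mem_univ, true_and] at h ⊢
    refine ⟨h.1, (hw0 a b h.1).2 ?_⟩
    by_contra hc
    have := lt_of_no_desc' wS a b h.1 (fun s hs hh => hc ⟨s, hwS ▸ hs, hh⟩)
    exact absurd this (not_lt.2 h.2.le)
  have heq := Finset.eq_of_subset_of_card_le hsub (hwSmax w0 hd)
  rw [← hw0 x y hxy]
  have := Finset.ext_iff.1 heq (x, y)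
  simp only [Finset.mem_filter, Finset.mem_univ, true_and, hxy] at this
  exact this

lemma card_ge_filter (n s : ℕ) (hs : s ≤ n) :
    (Finset.univ.filter fun x : Fin n => s ≤ (x : ℕ)).card = n - s := by
  have h := Finset.card_filter_add_card_filter_not (s := (Finset.univ : Finset (Fin n)))
    (fun x : Fin n => (x : ℕ) < s)
  rw [Fin.card_filter_val_lt, Finset.card_univ, Fintype.card_fin] at h
  have e : (Finset.univ.filter fun x : Fin n => ¬ (x : ℕ) < s) =
    (Finset.univ.filter fun x : Fin n => s ≤ (x : ℕ)) := by
    refine Finset.filter_congr fun x _ => by omega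
  rw [e] at h
  omega

lemma wS_split {n : ℕ} (wS : Equiv.Perm (Fin n)) (s : ℕ) (hs : s ≤ n)
    (h : ∀ x y : Fin n, (x : ℕ) < s → s ≤ (y : ℕ) → wS y < wS x) :
    (∀ x : Fin n, (x : ℕ) < s → n - s ≤ wS x) ∧ ∀ y : Fin n, s ≤ (y : ℕ) → (wS y : ℕ) < n - s := by
  constructor
  · intro x hx
    have h1 : ((Finset.univ.filter fun y : Fin n => s ≤ (y : ℕ)).map wS.toEmbedding) ⊆
        Finset.univ.filter fun v : Fin n => (v : ℕ) < wS x := by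
      intro v hv
      simp only [Finset.mem_map, Finset.mem_filter, Finset.mem_univ, true_and] at hv ⊢
      obtain ⟨y, hy, rfl⟩ := hv
      exact h x y hx hy
    have h2 := Finset.card_le_card h1
    rw [Finset.card_map, card_ge_filter n s hs, Fin.card_filter_val_lt] at h2
    omega
  · intro y hy
    have h1 : ((Finset.univ.filter fun x : Fin n => (x : ℕ) < s).map wS.toEmbedding) ⊆
        Finset.univ.filter fun v : Fin n => (wS y : ℕ) + 1 ≤ (v : ℕ) := by
      intro v hv
      simp only [Finset.mem_map, Finset.mem_filter, Finset.mem_univ, true_and] at hv ⊢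
      obtain ⟨x, hx, rfl⟩ := hv
      exact h x y hx hy
    have h2 := Finset.card_le_card h1
    have := (wS y).2
    rw [Finset.card_map, card_ge_filter n _ (by omega), Fin.card_filter_val_lt] at h2
    have := y.2
    omega

lemma desc_ext {n : ℕ} (S : Finset ℕ) (hS : S ⊆ Finset.Icc 1 (n - 1))
    (wS : Equiv.Perm (Fin n)) (hwS : descentSet wS = S) (s : ℕ) (hs : s ≤ n)
    (hsS : s = 0 ∨ s = n ∨ s ∈ S)
    (hlt : ∀ y : Fin n, s ≤ (y : ℕ) → (wS y : ℕ) < n - s)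
    (w : Equiv.Perm (Fin n)) (w' : Equiv.Perm (Fin s))
    (h1 : ∀ (x : ℕ) (hx : x < s), (w ⟨x, by omega⟩ : ℕ) = w' ⟨x, hx⟩ + (n - s))
    (h2 : ∀ (x : Fin n), s ≤ (x : ℕ) → w x = wS x) :
    descentSet w = S ↔ descentSet w' = S.filter (· < s) := by
  have key1 : ∀ d, d < s → (d ∈ descentSet w ↔ d ∈ descentSet w') := by
    intro d hd
    rw [mem_descentSet', mem_descentSet']
    constructor
    · rintro ⟨a, b, c⟩
      refine ⟨a, hd, ?_⟩
      rw [Fin.lt_def, h1 _ hd, h1 _ (by omega)] at c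
      exact Fin.lt_def.2 (by omega)
    · rintro ⟨a, b, c⟩
      refine ⟨a, by omega, ?_⟩
      rw [Fin.lt_def, h1 _ hd, h1 _ (by omega)]
      have := Fin.lt_def.1 c
      omega
  have key2 : ∀ d, s ≤ d → (d ∈ descentSet w ↔ d ∈ S) := by
    intro d hd
    rcases Nat.lt_or_ge s d with h | h
    · rw [← hwS, mem_descentSet', mem_descentSet']
      constructor
      · rintro ⟨a, b, c⟩
        refine ⟨a, b, ?_⟩
        rwa [h2 _ (by simpa using hd), h2 _ (by simp; omega)] at c
      · rintro ⟨a, b, c⟩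
        refine ⟨a, b, ?_⟩
        rwa [h2 _ (by simpa using hd), h2 _ (by simp; omega)]
    · obtain rfl : d = s := by omega
      constructor
      · intro h
        obtain ⟨a, b, c⟩ := (mem_descentSet' _ _).1 h
        rcases hsS with e | e | e
        · omega
        · omega
        · exact e
      · intro h
        have hh := Finset.mem_Icc.1 (hS h)
        rw [mem_descentSet']
        refine ⟨hh.1, by omega, ?_⟩
        rw [Fin.lt_def, h2 _ (by simp), h1 (d - 1) (by omega)]
        have := hlt ⟨d, by omega⟩ le_rfl
        omega
  constructor
  · intro h
    ext d
    rw [Finset.mem_filter]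
    constructor
    · intro hd
      obtain ⟨_, hds, _⟩ := (mem_descentSet' _ _).1 hd
      exact ⟨h ▸ (key1 d hds).2 hd, hds⟩
    · rintro ⟨hd, hds⟩
      exact (key1 d hds).1 (h.symm ▸ hd)
  · intro h
    ext d
    rcases Nat.lt_or_ge d s with hd | hd
    · rw [key1 d hd, h, Finset.mem_filter]
      exact ⟨fun h => h.1, fun h => ⟨h, hd⟩⟩
    · exact key2 d hd

lemma card_agree {n : ℕ} (S : Finset ℕ) (hS : S ⊆ Finset.Icc 1 (n - 1))
    (wS : Equiv.Perm (Fin n)) (hwS : descentSet wS = S)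
    (hwSmax : ∀ v : Equiv.Perm (Fin n), descentSet v = S → invCount v ≤ invCount wS)
    (s : ℕ) (hs : s ≤ n) (hsS : s = 0 ∨ s = n ∨ s ∈ S) :
    Nat.card {w : Equiv.Perm (Fin n) // descentSet w = S ∧
      ∀ x, s < x → x ≤ n → permApp w x = permApp wS x} =
    numDescentSet s (S.filter (· < s)) := by
  have hsp := wS_split wS s hs (by
    intro x y hx hy
    refine (wS_inv S hS wS hwS hwSmax x y (Fin.lt_def.2 (by omega))).2 ⟨s, ?_, hx, hy⟩
    rcases hsS with e | e | e
    · omega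
    · have := y.2; omega
    · exact e)
  have hagree : ∀ w : Equiv.Perm (Fin n), (∀ x, s < x → x ≤ n → permApp w x = permApp wS x) ↔
      ∀ x : Fin n, s ≤ (x : ℕ) → w x = wS x := by
    intro w
    constructor
    · intro h x hx
      have := h (x + 1) (by omega) (by omega)
      unfold permApp at this
      simp only [Nat.add_sub_cancel, x.2, dif_pos] at this
      exact Fin.ext (by simpa using this)
    · intro h x hx hxn
      unfold permApp
      have hx1 : x - 1 < n := by omega
      rw [dif_pos hx1, dif_pos hx1, h _ (by simp; omega)]
  unfold numDescentSet
  -- the extension map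
  have hE : ∀ w' : Equiv.Perm (Fin s), ∃ w : Equiv.Perm (Fin n),
      (∀ (x : ℕ) (hx : x < s), (w ⟨x, by omega⟩ : ℕ) = w' ⟨x, hx⟩ + (n - s)) ∧
      ∀ (x : Fin n), s ≤ (x : ℕ) → w x = wS x := by
    intro w'
    let f : Fin n → Fin n := fun x => if h : (x : ℕ) < s then
      ⟨w' ⟨x, h⟩ + (n - s), by have := (w' ⟨x, h⟩).2; omega⟩ else wS x
    have f1 : ∀ (x : Fin n) (h : (x : ℕ) < s), (f x : ℕ) = w' ⟨x, h⟩ + (n - s) := by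
      intro x h
      simp only [f, dif_pos h]
    have f2 : ∀ (x : Fin n), s ≤ (x : ℕ) → f x = wS x := by
      intro x h
      simp only [f, dif_neg (not_lt.2 h)]
    have finj : Function.Injective f := by
      intro x y hxy
      have hv := congrArg Fin.val hxy
      rcases Nat.lt_or_ge x s with hx | hx <;> rcases Nat.lt_or_ge y s with hy | hy
      · rw [f1 x hx, f1 y hy] at hv
        have : w' ⟨x, hx⟩ = w' ⟨y, hy⟩ := Fin.ext (by omega)
        have := congrArg Fin.val (w'.injective this)
        exact Fin.ext this
      · rw [f1 x hx, f2 y hy] at hv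
        have := hsp.2 y hy
        omega
      · rw [f1 y hy, f2 x hx] at hv
        have := hsp.2 x hx
        omega
      · rw [f2 x hx, f2 y hy] at hxy
        exact wS.injective hxy
    exact ⟨Equiv.ofBijective f (Finite.injective_iff_bijective.1 finj),
      fun x hx => f1 ⟨x, by omega⟩ hx, fun x hx => f2 x hx⟩
  choose E hE1 hE2 using hE
  symm
  refine Nat.card_eq_of_bijective (fun w' : {w' : Equiv.Perm (Fin s) // descentSet w' = S.filter (· < s)} =>
    (⟨E w'.1, (desc_ext S hS wS hwS s hs hsS hsp.2 (E w'.1) w'.1 (hE1 w'.1) (hE2 w'.1)).2 w'.2,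
      (hagree _).2 (hE2 w'.1)⟩ : {w : Equiv.Perm (Fin n) // descentSet w = S ∧
      ∀ x, s < x → x ≤ n → permApp w x = permApp wS x})) ⟨?_, ?_⟩
  · rintro ⟨a, ha⟩ ⟨b, hb⟩ hab
    have hab' : E a = E b := congrArg Subtype.val hab
    apply Subtype.ext
    apply Equiv.ext
    intro x
    have h1 := hE1 a x x.2
    rw [hab', hE1 b x x.2] at h1
    apply Fin.ext
    show (a x : ℕ) = b x
    simp only [Fin.eta] at h1
    omega
  · rintro ⟨w, hw, hwa⟩
    have hw2 := (hagree w).1 hwa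
    have hge : ∀ x : Fin n, (x : ℕ) < s → n - s ≤ w x := by
      intro x hx
      by_contra hc
      set y := wS.symm (w x) with hy
      have hwy : wS y = w x := by simp [hy]
      rcases Nat.lt_or_ge y s with h | h
      · have := hsp.1 y h
        rw [hwy] at this
        omega
      · rw [← hw2 y h] at hwy
        have := w.injective hwy
        rw [this] at h
        omega
    let f : Fin s → Fin s := fun x => ⟨(w ⟨x, by omega⟩ : ℕ) - (n - s), by
      have := (w ⟨x, by omega⟩).2
      have := x.2
      omega⟩
    have finj : Function.Injective f := by
      intro x y hxy
      have hv := congrArg Fin.val hxy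
      simp only [f] at hv
      have h1 := hge ⟨x, by omega⟩ x.2
      have h2 := hge ⟨y, by omega⟩ y.2
      have : w ⟨x, by omega⟩ = w ⟨y, by omega⟩ := Fin.ext (by omega)
      have := congrArg Fin.val (w.injective this)
      exact Fin.ext this
    let w' : Equiv.Perm (Fin s) := Equiv.ofBijective f (Finite.injective_iff_bijective.1 finj)
    have hw' : ∀ (x : ℕ) (hx : x < s), (w ⟨x, by omega⟩ : ℕ) = w' ⟨x, hx⟩ + (n - s) := by
      intro x hx
      have h1 := hge ⟨x, by omega⟩ hx
      show _ = ((w ⟨x, by omega⟩ : ℕ) - (n - s)) + (n - s)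
      omega
    refine ⟨⟨w', (desc_ext S hS wS hwS s hs hsS hsp.2 w w' hw' hw2).1 hw⟩, ?_⟩
    apply Subtype.ext
    apply Equiv.ext
    intro x
    show E w' x = w x
    rcases Nat.lt_or_ge x s with h | h
    · apply Fin.ext
      rw [hw' x h]
      exact hE1 w' x h
    · rw [hE2 w' x h, hw2 x h]


/-! ### Inclusion-exclusion -/

lemma incl_excl (V D : Finset ℕ) :
    ∑ T ∈ V.powerset, (-1 : ℤ) ^ (V.card - T.card) * (if D ⊆ T then 1 else 0) =
      if D = V then 1 else 0 := by
  by_cases hDV : D ⊆ V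
  · have h := Finset.prod_add (fun _ => (1 : ℤ)) (fun v => if v ∈ D then (0 : ℤ) else -1) V
    have h1 : ∀ T ∈ V.powerset, (∏ _i ∈ T, (1 : ℤ)) * ∏ i ∈ V \ T, (if i ∈ D then (0 : ℤ) else -1) =
        (-1 : ℤ) ^ (V.card - T.card) * (if D ⊆ T then 1 else 0) := by
      intro T hT
      rw [Finset.prod_const_one, one_mul]
      by_cases hDT : D ⊆ T
      · rw [if_pos hDT, mul_one, ← Finset.card_sdiff_of_subset (Finset.mem_powerset.1 hT),
          ← Finset.prod_const]
        refine Finset.prod_congr rfl fun i hi => ?_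
        rw [if_neg]
        intro hd
        exact (Finset.mem_sdiff.1 hi).2 (hDT hd)
      · rw [if_neg hDT, mul_zero]
        obtain ⟨d, hd, hdT⟩ := Finset.not_subset.1 hDT
        exact Finset.prod_eq_zero (Finset.mem_sdiff.2 ⟨hDV hd, hdT⟩) (if_pos hd)
    rw [← Finset.sum_congr rfl h1, ← h]
    by_cases hE : D = V
    · rw [if_pos hE]
      refine Finset.prod_eq_one fun i hi => ?_
      rw [if_pos (hE ▸ hi), add_zero]
    · rw [if_neg hE]
      obtain ⟨v, hv, hvD⟩ := Finset.not_subset.1 (fun h : V ⊆ D => hE (Finset.Subset.antisymm hDV h))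
      refine Finset.prod_eq_zero hv ?_
      rw [if_neg hvD]
      norm_num
  · rw [if_neg (fun h : D = V => hDV h.subset)]
    refine Finset.sum_eq_zero fun T hT => ?_
    rw [if_neg (fun h => hDV (h.trans (Finset.mem_powerset.1 hT))), mul_zero]

lemma sum_Aperm (s : ℕ) (V : Finset ℕ) :
    ∑ T ∈ V.powerset, (-1 : ℤ) ^ (V.card - T.card) * (Aperm s (insert s T) : ℤ) =
      (numDescentSet s V : ℤ) := by
  have h1 : ∀ T, (Aperm s (insert s T) : ℤ) =
      ∑ w : Equiv.Perm (Fin s), if descentSet w ⊆ T then (1 : ℤ) else 0 := by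
    intro T
    unfold Aperm
    rw [Nat.card_eq_fintype_card, Fintype.card_subtype, ← Finset.sum_boole]
    refine Finset.sum_congr rfl fun w _ => ?_
    congr 1
    apply propext
    constructor
    · intro h d hd
      obtain ⟨_, h2, _⟩ := (mem_descentSet' w d).1 hd
      rcases Finset.mem_insert.1 (h hd) with e | e
      · omega
      · exact e
    · intro h
      exact h.trans (Finset.subset_insert _ _)
  simp_rw [h1, Finset.mul_sum]
  rw [Finset.sum_comm]
  simp_rw [incl_excl]
  unfold numDescentSet
  rw [Nat.card_eq_fintype_card, Fintype.card_subtype, ← Finset.sum_boole]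

lemma sum_powerset_max (U : Finset ℕ) (f : Finset ℕ → ℤ) :
    ∑ T ∈ U.powerset, f T =
      f ∅ + ∑ s ∈ U, ∑ T ∈ (U.filter (· < s)).powerset, f (insert s T) := by
  induction U using Finset.induction_on_max with
  | empty => simp
  | insert a U ha ih =>
    have hn : a ∉ U := fun h => lt_irrefl _ (ha a h)
    rw [Finset.sum_powerset_insert hn, ih, Finset.sum_insert hn]
    have e1 : (insert a U).filter (· < a) = U := by
      ext x
      simp only [Finset.mem_filter, Finset.mem_insert]
      constructor
      · rintro ⟨h | h, h'⟩
        · omega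
        · exact h
      · intro h
        exact ⟨Or.inr h, ha x h⟩
    have e2 : ∀ s ∈ U, (insert a U).filter (· < s) = U.filter (· < s) := by
      intro s hs
      rw [Finset.filter_insert, if_neg (not_lt.2 (ha s hs).le)]
    have e3 : ∑ s ∈ U, ∑ T ∈ ((insert a U).filter (· < s)).powerset, f (insert s T) =
        ∑ s ∈ U, ∑ T ∈ (U.filter (· < s)).powerset, f (insert s T) :=
      Finset.sum_congr rfl (fun s hs => by rw [e2 s hs])
    rw [e1, e3]
    ring

lemma sum_group (U : Finset ℕ) (h0 : 0 ∉ U) (h : ℕ → ℤ) :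
    ∑ T ∈ U.powerset, (-1 : ℤ) ^ (U.card - T.card) * ((Aperm (T.sup id) T : ℤ) * h (T.sup id)) =
    ∑ s ∈ insert 0 U, (-1 : ℤ) ^ (U.filter (s < ·)).card *
      ((numDescentSet s (U.filter (· < s)) : ℤ) * h s) := by
  rw [sum_powerset_max, Finset.sum_insert h0]
  congr 1
  · have e1 : U.filter (0 < ·) = U := by
      refine Finset.filter_true_of_mem fun x hx => ?_
      exact Nat.pos_of_ne_zero fun e => h0 (e ▸ hx)
    have e2 : U.filter (· < 0) = ∅ := by simp
    rw [e1, e2]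
    simp only [Finset.card_empty, Nat.sub_zero, Finset.sup_empty]
    congr 3
    unfold Aperm numDescentSet
    simp only [Finset.subset_empty]
    rfl
  · refine Finset.sum_congr rfl fun s hs => ?_
    rw [← sum_Aperm, Finset.sum_mul, Finset.mul_sum]
    refine Finset.sum_congr rfl fun T hT => ?_
    have hT' := Finset.mem_powerset.1 hT
    have hlt : ∀ x ∈ T, x < s := fun x hx => (Finset.mem_filter.1 (hT' hx)).2
    have hsup : (insert s T).sup id = s := by
      rw [Finset.sup_insert]
      refine sup_eq_left.2 (Finset.sup_le fun x hx => (hlt x hx).le)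
    have hsT : s ∉ T := fun hh => lt_irrefl _ (hlt s hh)
    have hcard : (U.filter (· < s)).card + 1 + (U.filter (s < ·)).card = U.card := by
      have e : U = insert s (U.filter (· < s)) ∪ U.filter (s < ·) := by
        ext x
        simp only [Finset.mem_union, Finset.mem_insert, Finset.mem_filter]
        constructor
        · intro hx
          rcases lt_trichotomy x s with h | h | h
          · exact Or.inl (Or.inr ⟨hx, h⟩)
          · exact Or.inl (Or.inl h)
          · exact Or.inr ⟨hx, h⟩
        · rintro ((rfl | h) | h)
          · exact hs
          · exact h.1
          · exact h.1
      conv_rhs => rw [e]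
      rw [Finset.card_union_of_disjoint, Finset.card_insert_of_notMem]
      · simp
      · rw [Finset.disjoint_left]
        intro x hx hx'
        simp only [Finset.mem_insert, Finset.mem_filter] at hx hx'
        omega
    have hc := Finset.card_le_card hT'
    rw [hsup, Finset.card_insert_of_notMem hsT]
    have : U.card - (T.card + 1) = (U.filter (s < ·)).card + ((U.filter (· < s)).card - T.card) := by
      omega
    rw [this, pow_add]
    ring

/-! ### The elements of S in increasing order -/

lemma sElt_mem {n : ℕ} (S : Finset ℕ) (j : ℕ) (h1 : 1 ≤ j) (h2 : j ≤ S.card) : sElt n S j ∈ S := by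
  unfold sElt
  rw [if_neg (by omega), if_pos h2, List.getD_eq_getElem _ _ (by rw [Finset.length_sort]; omega)]
  exact (Finset.mem_sort (· ≤ ·)).1 (List.getElem_mem _)

lemma sElt_lt {n : ℕ} (hn : 0 < n) (S : Finset ℕ) (hS : S ⊆ Finset.Icc 1 (n - 1)) (j j' : ℕ)
    (h : j < j') (h' : j' ≤ S.card + 1) : sElt n S j < sElt n S j' := by
  have hb : ∀ j, 1 ≤ j → j ≤ S.card → 1 ≤ sElt n S j ∧ sElt n S j ≤ n - 1 := fun j h1 h2 =>
    Finset.mem_Icc.1 (hS (sElt_mem S j h1 h2))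
  rcases Nat.lt_or_ge S.card j' with hj' | hj'
  · rw [sElt_of_gt n S j' hj']
    rcases Nat.eq_zero_or_pos j with h0 | h0
    · subst h0
      simpa [sElt] using hn
    · have := hb j h0 (by omega)
      omega
  · rcases Nat.eq_zero_or_pos j with h0 | h0
    · subst h0
      have := hb j' h hj'
      simp only [sElt, if_pos] at this ⊢
      omega
    · unfold sElt
      rw [if_neg (by omega), if_pos (by omega), if_neg (by omega), if_pos hj',
        List.getD_eq_getElem _ _ (by rw [Finset.length_sort]; omega),
        List.getD_eq_getElem _ _ (by rw [Finset.length_sort]; omega)]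
      exact List.pairwise_iff_getElem.1 (Finset.sortedLT_sort S).pairwise _ _ _ _ (by omega)

lemma sElt_le {n : ℕ} (hn : 0 < n) (S : Finset ℕ) (hS : S ⊆ Finset.Icc 1 (n - 1)) (j j' : ℕ)
    (h : j ≤ j') (h' : j' ≤ S.card + 1) : sElt n S j ≤ sElt n S j' := by
  rcases h.eq_or_lt with e | e
  · rw [e]
  · exact (sElt_lt hn S hS j j' e h').le

lemma sElt_image {n : ℕ} (hn : 0 < n) (S : Finset ℕ) (hS : S ⊆ Finset.Icc 1 (n - 1)) :
    (Finset.range (S.card + 2)).image (sElt n S) = insert 0 (insert n S) := by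
  have hnS : n ∉ S := fun h => by have := Finset.mem_Icc.1 (hS h); omega
  have h0 : 0 ∉ insert n S := by
    intro h
    rcases Finset.mem_insert.1 h with e | e
    · omega
    · have := Finset.mem_Icc.1 (hS e); omega
  apply Finset.eq_of_subset_of_card_le
  · intro x hx
    obtain ⟨j, hj, rfl⟩ := Finset.mem_image.1 hx
    rw [Finset.mem_range] at hj
    rw [Finset.mem_insert, Finset.mem_insert]
    rcases Nat.eq_zero_or_pos j with h0 | h0
    · left
      subst h0
      simp [sElt]
    · rcases Nat.lt_or_ge S.card j with h | h
      · right; left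
        exact sElt_of_gt n S j h
      · right; right
        exact sElt_mem S j h0 h
  · rw [Finset.card_insert_of_notMem h0, Finset.card_insert_of_notMem hnS,
      Finset.card_image_of_injOn, Finset.card_range]
    intro a ha b hb hab
    simp only [Finset.coe_range, Set.mem_Iio] at ha hb
    by_contra hne
    rcases lt_or_gt_of_ne hne with h | h
    · have := sElt_lt hn S hS a b h (by omega); omega
    · have := sElt_lt hn S hS b a h (by omega); omega

lemma sElt_card {n : ℕ} (hn : 0 < n) (S : Finset ℕ) (hS : S ⊆ Finset.Icc 1 (n - 1)) (j : ℕ)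
    (hj : j ≤ S.card + 1) : ((insert n S).filter (sElt n S j < ·)).card = S.card + 1 - j := by
  have e : (insert n S).filter (sElt n S j < ·) =
      (Finset.Ioc j (S.card + 1)).image (sElt n S) := by
    ext x
    rw [Finset.mem_filter, Finset.mem_image]
    constructor
    · rintro ⟨hx, hlt⟩
      have hx' : x ∈ insert 0 (insert n S) := Finset.mem_insert_of_mem hx
      rw [← sElt_image hn S hS, Finset.mem_image] at hx'
      obtain ⟨i, hi, rfl⟩ := hx'
      rw [Finset.mem_range] at hi
      refine ⟨i, Finset.mem_Ioc.2 ⟨?_, by omega⟩, rfl⟩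
      by_contra hc
      have := sElt_le hn S hS i j (by omega) hj
      omega
    · rintro ⟨i, hi, rfl⟩
      rw [Finset.mem_Ioc] at hi
      have hlt := sElt_lt hn S hS j i hi.1 hi.2
      refine ⟨?_, hlt⟩
      have : sElt n S i ∈ insert 0 (insert n S) := by
        rw [← sElt_image hn S hS]
        exact Finset.mem_image_of_mem _ (Finset.mem_range.2 (by omega))
      rcases Finset.mem_insert.1 this with e | e
      · omega
      · exact e
  rw [e, Finset.card_image_of_injOn, Nat.card_Ioc]
  intro a ha b hb hab
  simp only [Finset.coe_Ioc, Set.mem_Ioc] at ha hb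
  by_contra hne
  rcases lt_or_gt_of_ne hne with h | h
  · have := sElt_lt hn S hS a b h (by omega); omega
  · have := sElt_lt hn S hS b a h (by omega); omega

lemma sum_sElt {n : ℕ} (hn : 0 < n) (S : Finset ℕ) (hS : S ⊆ Finset.Icc 1 (n - 1)) (F : ℕ → ℤ) :
    ∑ s ∈ insert 0 (insert n S), (-1 : ℤ) ^ ((insert n S).filter (s < ·)).card * F s =
      ∑ i ∈ Finset.range (S.card + 2), (-1 : ℤ) ^ i * F (sElt n S (S.card + 1 - i)) := by
  rw [← sElt_image hn S hS, Finset.sum_image]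
  · rw [← Finset.sum_range_reflect]
    refine Finset.sum_congr rfl fun i hi => ?_
    rw [Finset.mem_range] at hi
    rw [show S.card + 2 - 1 - i = S.card + 1 - i by omega, sElt_card hn S hS _ (by omega)]
    congr 2
    omega
  · intro a ha b hb hab
    simp only [Finset.coe_range, Set.mem_Iio] at ha hb
    by_contra hne
    rcases lt_or_gt_of_ne hne with h | h
    · have := sElt_lt hn S hS a b h (by omega); omega
    · have := sElt_lt hn S hS b a h (by omega); omega

/-! ### Parity of the statistic -/

lemma alt_sum (t : ℕ) : ∑ i ∈ Finset.range (t + 1), (-1 : ℤ) ^ i = if Even t then 1 else 0 := by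
  induction t with
  | zero => simp
  | succ t ih =>
    rw [Finset.sum_range_succ, ih]
    by_cases h : Even t
    · rw [if_pos h, if_neg (by rw [Nat.even_add_one]; exact not_not.2 h), pow_succ, h.neg_one_pow]
      norm_num
    · rw [if_neg h, if_pos (by rw [Nat.even_add_one]; exact h), pow_succ,
        (Nat.not_even_iff_odd.1 h).neg_one_pow]
      norm_num

lemma even_max (m : ℕ) (p : ℕ → Prop) [DecidablePred p] (hp : ∀ i j, i ≤ j → j < m → p j → p i)
    (hne : ((Finset.range m).filter p).Nonempty) :
    (if Even (((Finset.range m).filter p).max' hne) then (1 : ℤ) else 0) =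
      ∑ i ∈ Finset.range m, (-1 : ℤ) ^ i * (if p i then 1 else 0) := by
  set t := ((Finset.range m).filter p).max' hne with ht
  have htm : t ∈ (Finset.range m).filter p := Finset.max'_mem _ _
  rw [Finset.mem_filter, Finset.mem_range] at htm
  have e : (Finset.range m).filter p = Finset.range (t + 1) := by
    ext i
    constructor
    · intro hi
      have := Finset.le_max' _ i hi
      rw [Finset.mem_range]
      omega
    · intro hi
      rw [Finset.mem_range] at hi
      exact Finset.mem_filter.2 ⟨Finset.mem_range.2 (by omega), hp i t (by omega) htm.1 htm.2⟩
  rw [← alt_sum, ← e, Finset.sum_filter]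
  refine Finset.sum_congr rfl fun i _ => ?_
  split_ifs <;> simp

/-! ### Counting coloured tableaux -/

lemma card_zeroFirstRow (μ : YoungDiagram) (r : ℕ) (hr : 0 < r) (m : ℕ) (hm : m ≤ μ.card) :
    Nat.card {q : SYT μ × (Fin μ.card → ZMod r) // zeroFirstRow q.1 q.2 m} =
      Gs μ m * r ^ (μ.card - m) := by
  have : NeZero r := ⟨hr.ne'⟩
  have hiff : ∀ q : SYT μ × (Fin μ.card → ZMod r), zeroFirstRow q.1 q.2 m ↔
      frow q.1 m ∧ ∀ k : Fin μ.card, (k : ℕ) < m → q.2 k = 0 := by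
    intro q
    constructor
    · intro h
      refine ⟨fun k h1 h2 => ?_, fun k hk => (h k hk).2⟩
      obtain ⟨⟨j, hj1, hj2⟩, _⟩ := h ⟨k - 1, by omega⟩ (by simp only; omega)
      refine ⟨j, hj1, ?_⟩
      rw [hj2]
      simp only
      omega
    · rintro ⟨h1, h2⟩ k hk
      exact ⟨h1 (k + 1) (by omega) (by omega), h2 k hk⟩
  rw [Nat.card_congr (Equiv.subtypeEquivRight hiff),
    Nat.card_congr (Equiv.subtypeProdEquivProd (p := fun Q : SYT μ => frow Q m)
      (q := fun c : Fin μ.card → ZMod r => ∀ k : Fin μ.card, (k : ℕ) < m → c k = 0)), Nat.card_prod]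
  congr 1
  have hc : (Finset.univ.filter fun c : Fin μ.card → ZMod r => ∀ k : Fin μ.card, (k : ℕ) < m → c k = 0) =
      Fintype.piFinset (fun k : Fin μ.card => if (k : ℕ) < m then ({0} : Finset (ZMod r)) else Finset.univ) := by
    ext c
    simp only [Finset.mem_filter, Finset.mem_univ, true_and, Fintype.mem_piFinset]
    refine forall_congr' fun k => ?_
    split_ifs with h <;> simp [h]
  rw [Nat.card_eq_fintype_card, Fintype.card_subtype, hc, Fintype.card_piFinset]
  have : ∀ k : Fin μ.card, (if (k : ℕ) < m then ({0} : Finset (ZMod r)) else Finset.univ).card =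
      if m ≤ (k : ℕ) then r else 1 := by
    intro k
    split_ifs
    · omega
    · simp
    · simp [ZMod.card]
    · omega
  simp_rw [this]
  rw [Finset.prod_ite, Finset.prod_const_one, mul_one, Finset.prod_const, card_ge_filter _ _ hm]

theorem main11 (n r : ℕ) (hn : 0 < n) (hr : 0 < r) (μ : YoungDiagram)
    (hμ : μ.card = n) (S : Finset ℕ) (hS : S ⊆ Finset.Icc 1 (n - 1))
    (wS : Equiv.Perm (Fin n)) (hwS : descentSet wS = S)
    (hwSmax : ∀ v : Equiv.Perm (Fin n), descentSet v = S → invCount v ≤ invCount wS) :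
    (∑ g : Equiv.Perm (Fin n), cBeta n r (insert n S) g * chi n μ g⁻¹) =
      (Nat.card {p : Equiv.Perm (Fin n) × SYT μ × (Fin μ.card → ZMod r) //
          descentSet p.1 = S ∧ Even (ctau n S wS p.1 p.2.1 p.2.2)} : ℤ) *
        (n.factorial : ℤ) := by
  have : NeZero r := ⟨hr.ne'⟩
  have := Fintype.ofFinite (SYT μ)
  have hU : insert n S ⊆ Finset.Icc 1 n := by
    intro x hx
    rw [Finset.mem_Icc]
    rcases Finset.mem_insert.1 hx with e | e
    · omega
    · have := Finset.mem_Icc.1 (hS e); omega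
  have h0 : 0 ∉ insert n S := fun h => by have := Finset.mem_Icc.1 (hU h); omega
  -- the left-hand side
  have hL : (∑ g : Equiv.Perm (Fin n), cBeta n r (insert n S) g * chi n μ g⁻¹) =
      (∑ T ∈ (insert n S).powerset, (-1 : ℤ) ^ ((insert n S).card - T.card) *
        ((Aperm (T.sup id) T : ℤ) * ((r : ℤ) ^ (T.sup id) * (Gs μ (n - T.sup id) : ℤ)))) *
        (n.factorial : ℤ) := by
    have e1 : ∀ g : Equiv.Perm (Fin n), cBeta n r (insert n S) g =
      ∑ T ∈ (insert n S).powerset, (-1 : ℤ) ^ ((insert n S).card - T.card) * cAlpha n r T g :=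
      fun g => rfl
    simp_rw [e1, Finset.sum_mul]
    rw [Finset.sum_comm]
    refine Finset.sum_congr rfl fun T hT => ?_
    have hTU := (Finset.mem_powerset.1 hT).trans hU
    have hsup : T.sup id ≤ n := Finset.sup_le fun x hx => (Finset.mem_Icc.1 (hTU hx)).2
    have hc := chi_sum n (T.sup id) μ hμ hsup
    calc _ = ∑ g : Equiv.Perm (Fin n), ((-1 : ℤ) ^ ((insert n S).card - T.card) *
          ((Aperm (T.sup id) T : ℤ) * (r : ℤ) ^ (T.sup id))) *
          ((injFix n (T.sup id) g : ℤ) * chi n μ g⁻¹) := by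
          refine Finset.sum_congr rfl fun g _ => ?_
          rw [alpha_count T hTU hr g]
          ring
      _ = _ := by
          rw [← Finset.mul_sum, hc]
          ring
  rw [hL, sum_group _ h0 (fun s => (r : ℤ) ^ s * (Gs μ (n - s) : ℤ)), sum_sElt hn S hS
    (fun s => (numDescentSet s ((insert n S).filter (· < s)) : ℤ) * ((r : ℤ) ^ s * (Gs μ (n - s) : ℤ)))]
  congr 1
  -- the right-hand side
  let cond : ℕ → Equiv.Perm (Fin n) × SYT μ × (Fin μ.card → ZMod r) → Prop := fun i p =>
    (∀ x, sElt n S (S.card + 1 - i) < x → x ≤ n → permApp p.1 x = permApp wS x) ∧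
      zeroFirstRow p.2.1 p.2.2 (n - sElt n S (S.card + 1 - i))
  have hev : ∀ p, (if Even (ctau n S wS p.1 p.2.1 p.2.2) then (1 : ℤ) else 0) =
      ∑ i ∈ Finset.range (S.card + 2), (-1 : ℤ) ^ i * (if cond i p then 1 else 0) := by
    intro p
    have hp : ∀ i j, i ≤ j → j < S.card + 2 → cond j p → cond i p := ?_
    · have hne : ((Finset.range (S.card + 2)).filter (fun i => cond i p)).Nonempty := by
        refine ⟨0, Finset.mem_filter.2 ⟨Finset.mem_range.2 (by omega), ?_, ?_⟩⟩
        · intro x hx hxn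
          rw [sElt_of_gt n S _ (by omega)] at hx
          omega
        · intro k hk
          rw [sElt_of_gt n S _ (by omega)] at hk
          omega
      rw [← even_max (S.card + 2) (fun i => cond i p) hp hne]
      unfold ctau
      congr!
    intro i j hij hj hc
    have hle := sElt_le hn S hS (S.card + 1 - j) (S.card + 1 - i) (by omega) (by omega)
    exact ⟨fun x hx hxn => hc.1 x (by omega) hxn, fun k hk => hc.2 k (by omega)⟩
  rw [Nat.card_eq_fintype_card, Fintype.card_subtype, ← Finset.sum_boole]
  have e2 : ∀ p : Equiv.Perm (Fin n) × SYT μ × (Fin μ.card → ZMod r),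
      (if descentSet p.1 = S ∧ Even (ctau n S wS p.1 p.2.1 p.2.2) then (1 : ℤ) else 0) =
      ∑ i ∈ Finset.range (S.card + 2), (-1 : ℤ) ^ i * (if descentSet p.1 = S ∧ cond i p then 1 else 0) := by
    intro p
    by_cases hd : descentSet p.1 = S
    · simp only [hd, true_and]
      exact hev p
    · simp only [hd, false_and, if_false, mul_zero, Finset.sum_const_zero]
  rw [Finset.sum_congr rfl (fun p _ => e2 p), Finset.sum_comm]
  refine Finset.sum_congr rfl fun i hi => ?_
  rw [Finset.mem_range] at hi
  rw [← Finset.mul_sum]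
  congr 1
  set s := sElt n S (S.card + 1 - i) with hs
  have hsm : s ∈ insert 0 (insert n S) := by
    rw [← sElt_image hn S hS]
    exact Finset.mem_image_of_mem _ (Finset.mem_range.2 (by omega))
  have hsS : s = 0 ∨ s = n ∨ s ∈ S := by
    simpa [Finset.mem_insert] using hsm
  have hsn : s ≤ n := by
    rcases hsS with e | e | e
    · omega
    · omega
    · have := Finset.mem_Icc.1 (hS e); omega
  have hf : (insert n S).filter (· < s) = S.filter (· < s) := by
    rw [Finset.filter_insert, if_neg (by omega)]
  rw [hf, ← card_agree S hS wS hwS hwSmax s hsn hsS, Finset.sum_boole, ← Fintype.card_subtype,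
    ← Nat.card_eq_fintype_card]
  have hz := card_zeroFirstRow μ r hr (n - s) (by omega)
  rw [show μ.card - (n - s) = s by omega] at hz
  have hprod : Nat.card {p : Equiv.Perm (Fin n) × SYT μ × (Fin μ.card → ZMod r) //
        descentSet p.1 = S ∧ cond i p} =
      Nat.card {w : Equiv.Perm (Fin n) // descentSet w = S ∧
        ∀ x, s < x → x ≤ n → permApp w x = permApp wS x} *
      Nat.card {q : SYT μ × (Fin μ.card → ZMod r) // zeroFirstRow q.1 q.2 (n - s)} := by
    rw [← Nat.card_prod, ← Nat.card_congr (Equiv.subtypeProdEquivProd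
      (p := fun w : Equiv.Perm (Fin n) => descentSet w = S ∧
        ∀ x, s < x → x ≤ n → permApp w x = permApp wS x)
      (q := fun q : SYT μ × (Fin μ.card → ZMod r) => zeroFirstRow q.1 q.2 (n - s)))]
    refine Nat.card_congr (Equiv.subtypeEquivRight fun p => ?_)
    simp only [cond, ← hs, and_assoc]
  rw [hprod, hz]
  push_cast
  ring


/-- **Theorem 4.1(b)**: `b_{r,λ}(S ∪ {n})` equals the number of pairs `(w,Q)` with
`w ∈ 𝔖_n` of descent set `S` and `Q` an `r`-colored standard Young tableau of shape `λ`
with `τ(w,Q)` even. -/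
theorem statement11 (n r : ℕ) (hn : 0 < n) (hr : 0 < r) (μ : YoungDiagram)
    (hμ : μ.card = n) (S : Finset ℕ) (hS : S ⊆ Finset.Icc 1 (n - 1))
    (wS : Equiv.Perm (Fin n)) (hwS : descentSet wS = S)
    (hwSmax : ∀ v : Equiv.Perm (Fin n), descentSet v = S → invCount v ≤ invCount wS) :
    (∑ g : Equiv.Perm (Fin n), cBeta n r (insert n S) g * chi n μ g⁻¹) =
      (Nat.card {p : Equiv.Perm (Fin n) × SYT μ × (Fin μ.card → ZMod r) //
          descentSet p.1 = S ∧ Even (ctau n S wS p.1 p.2.1 p.2.2)} : ℤ) *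
        (n.factorial : ℤ) := by
  exact main11 n r hn hr μ hμ S hS wS hwS hwSmax
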